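/- Fix integers i, j with 1 ≤ i ≤ j ≤ Δ and j ≥ 2. For a Δ-tree T of order n, let Y_n(T) denote the number of edges of T of type (i,j) (well defined on isomorphism classes), regarded as a random variable on 𝒯_n^Δ with the uniform distribution. Then there exists a real constant μ_{ij} such that for every ε > 0, the probability (under the uniform measure on 𝒯_n^Δ) that |Y_n − μ_{ij}·n| ≤ ε·n tends to 1 as n → ∞. -/

import Mathlib

open Filter Topology MeasureTheory

namespace TreePaper

/-- The degree of a vertex `v` in a simple graph on `Fin n`. -/
noncomputable def degr {n : ℕ} (G : SimpleGraph (Fin n)) (v : Fin n) : ℕ :=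
  Nat.card {u : Fin n // G.Adj v u}

/-- A `Δ`-tree of order `n`: a tree on `n` vertices with all degrees at most `Δ`. -/
abbrev DTree (Δ n : ℕ) : Type :=
  {G : SimpleGraph (Fin n) // G.IsTree ∧ ∀ v, degr G v ≤ Δ}

instance treeSetoid (Δ n : ℕ) : Setoid (DTree Δ n) where
  r G H := Nonempty (G.1 ≃g H.1)
  iseqv :=
    ⟨fun G => ⟨SimpleGraph.Iso.refl⟩, fun ⟨e⟩ => ⟨e.symm⟩, fun ⟨e⟩ ⟨f⟩ => ⟨e.trans f⟩⟩

/-- Isomorphism classes of `Δ`-trees of order `n`. -/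
abbrev TClass (Δ n : ℕ) : Type := Quotient (treeSetoid Δ n)

/-- The number of vertices of degree `j` in `G`. -/
noncomputable def vcount {n : ℕ} (j : ℕ) (G : SimpleGraph (Fin n)) : ℕ :=
  Nat.card {v : Fin n // degr G v = j}

/-- The number of vertices of degree `j`, as a random variable on iso classes. -/
noncomputable def Xdeg (Δ n j : ℕ) (c : TClass Δ n) : ℕ :=
  vcount j (Quotient.out c).1

/-- Probability of an event under the uniform measure on iso classes of `Δ`-trees. -/
noncomputable def prob (Δ n : ℕ) (P : TClass Δ n → Prop) : ℝ :=
  (Nat.card {c : TClass Δ n // P c} : ℝ) / (Nat.card (TClass Δ n) : ℝ)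

/-- Expectation under the uniform measure on iso classes of `Δ`-trees. -/
noncomputable def mean (Δ n : ℕ) (f : TClass Δ n → ℝ) : ℝ :=
  (∑ᶠ c : TClass Δ n, f c) / (Nat.card (TClass Δ n) : ℝ)

/-- Variance under the uniform measure on iso classes of `Δ`-trees. -/
noncomputable def variance (Δ n : ℕ) (f : TClass Δ n → ℝ) : ℝ :=
  (∑ᶠ c : TClass Δ n, (f c - mean Δ n f) ^ 2) / (Nat.card (TClass Δ n) : ℝ)

/-- The standard normal distribution function. -/
noncomputable def stdNormalCDF (t : ℝ) : ℝ :=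
  (Real.sqrt (2 * Real.pi))⁻¹ * ∫ s in Set.Iic t, Real.exp (-(s ^ 2) / 2)

end TreePaper

namespace TreePaper

/-- The number of edges of type `(i,j)` of `G`, i.e. edges one of whose endpoints has
degree `i` and the other degree `j`. -/
noncomputable def ecount {n : ℕ} (i j : ℕ) (G : SimpleGraph (Fin n)) : ℕ :=
  Nat.card {e : G.edgeSet // ∃ u v : Fin n,
    (e : Sym2 (Fin n)) = s(u, v) ∧ degr G u = i ∧ degr G v = j}

/-- The number of edges of type `(i,j)`, as a random variable on iso classes. -/
noncomputable def Yedge (Δ n i j : ℕ) (c : TClass Δ n) : ℕ :=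
  ecount i j (Quotient.out c).1

open scoped ENNReal

/-- Matula numbers: the natural numbers code the finite unordered rooted trees. -/
theorem exists_treeCode : ∃ e : ℕ ≃ Multiset ℕ, ∀ n, ∀ c ∈ e n, c < n := by
  have hinf : (Set.ofPred Nat.Prime).Infinite := Nat.infinite_setOfPred_prime
  have hfac : ∀ n : ℕ, ∀ p ∈ (Nat.primeFactorsList n : Multiset ℕ), p.Prime := fun n p hp =>
    Nat.prime_of_mem_primeFactorsList (by simpa using hp)
  have hmk : ∀ m : Multiset ℕ, (m.map (Nat.nth Nat.Prime)).prod ≠ 0 := by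
    intro m h
    rw [Multiset.prod_eq_zero_iff] at h
    obtain ⟨a, -, ha⟩ := Multiset.mem_map.1 h
    exact (Nat.nth_mem_of_infinite hinf a).ne_zero ha
  refine ⟨⟨fun n => (Nat.primeFactorsList (n + 1) : Multiset ℕ).map (Nat.count Nat.Prime),
    fun m => (m.map (Nat.nth Nat.Prime)).prod - 1, ?_, ?_⟩, ?_⟩
  · intro n
    have : (Multiset.map (Nat.nth Nat.Prime ∘ Nat.count Nat.Prime)
        (Nat.primeFactorsList (n + 1) : Multiset ℕ)) = Nat.primeFactorsList (n + 1) := by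
      conv_rhs => rw [← Multiset.map_id (Nat.primeFactorsList (n + 1) : Multiset ℕ)]
      exact Multiset.map_congr rfl fun p hp => Nat.nth_count (hfac _ p hp)
    simp only [Multiset.map_map, this, Multiset.prod_coe]
    rw [Nat.prod_primeFactorsList (by omega)]
    omega
  · intro m
    have h1 : (m.map (Nat.nth Nat.Prime)).prod - 1 + 1 = (m.map (Nat.nth Nat.Prime)).prod :=
      Nat.succ_pred_eq_of_ne_zero (hmk m)
    have h2 : (Nat.primeFactorsList (m.map (Nat.nth Nat.Prime)).prod : Multiset ℕ)
        = m.map (Nat.nth Nat.Prime) := by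
      induction m using Quotient.inductionOn with
      | h l =>
        simp only [Multiset.quot_mk_to_coe, Multiset.map_coe, Multiset.prod_coe,
          Multiset.coe_eq_coe]
        refine (Nat.primeFactorsList_unique rfl ?_).symm
        intro p hp
        obtain ⟨a, -, rfl⟩ := List.mem_map.1 hp
        exact Nat.nth_mem_of_infinite hinf a
    simp only [h1, h2, Multiset.map_map]
    conv_rhs => rw [← Multiset.map_id m]
    exact Multiset.map_congr rfl fun p _ => Nat.count_nth_of_infinite hinf p
  · intro n c hc
    obtain ⟨p, hp, rfl⟩ : ∃ p ∈ (Nat.primeFactorsList (n + 1) : Multiset ℕ),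
        Nat.count Nat.Prime p = c := Multiset.mem_map.1 hc
    have hpp := hfac _ p hp
    have hle : p ≤ n + 1 := Nat.le_of_mem_primeFactorsList (by simpa using hp)
    have h2 := hpp.two_le
    obtain ⟨q, rfl⟩ : ∃ q, p = 2 + q := ⟨p - 2, by omega⟩
    have : Nat.count Nat.Prime (2 + q) ≤ q := by
      rw [Nat.count_add]
      have : Nat.count Nat.Prime 2 = 0 := by decide
      rw [this, zero_add]
      exact Nat.count_le _
    omega

/-- The multiset of branches at the root of the rooted tree coded by a natural number. -/
noncomputable def branches : ℕ ≃ Multiset ℕ := exists_treeCode.choose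

theorem lt_of_mem_branches {n c : ℕ} (h : c ∈ branches n) : c < n :=
  exists_treeCode.choose_spec n c h

/-- The additive functional on coded rooted trees with toll function `g`. -/
noncomputable def fold (g : ℕ → ℕ) (n : ℕ) : ℕ :=
  g n + ((branches n).attach.map fun c => fold g c.1).sum
termination_by n
decreasing_by exact lt_of_mem_branches c.2

theorem fold_eq (g : ℕ → ℕ) (n : ℕ) : fold g n = g n + ((branches n).map (fold g)).sum := by
  rw [fold]
  congr 2
  exact Multiset.attach_map_val' _ (fold g)

/-- The number of branches at the root. -/
noncomputable def rootDeg (n : ℕ) : ℕ := Multiset.card (branches n)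

/-- The number of vertices of a coded rooted tree. -/
noncomputable def size : ℕ → ℕ := fold fun _ => 1

/-- The unordered pair `{a, b}` is `{i, j}`. -/
def PairMatch (i j a b : ℕ) : Prop := (a = i ∧ b = j) ∨ (a = j ∧ b = i)

instance (i j a b : ℕ) : Decidable (PairMatch i j a b) := by unfold PairMatch; infer_instance

/-- The number of edges of type `(i, j)` of a coded rooted tree hanging from a further vertex. -/
noncomputable def edges (i j : ℕ) : ℕ → ℕ :=
  fold fun n => (branches n).countP fun c => PairMatch i j (rootDeg n + 1) (rootDeg c + 1)

/-- All vertices of the coded rooted tree have fewer than `Δ` branches. -/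
def Bounded (Δ n : ℕ) : Prop := fold (fun n => if rootDeg n < Δ then 0 else 1) n = 0

theorem bounded_iff {Δ n : ℕ} :
    Bounded Δ n ↔ rootDeg n < Δ ∧ ∀ c ∈ branches n, Bounded Δ c := by
  unfold Bounded
  rw [fold_eq]
  simp [Multiset.sum_eq_zero_iff]

theorem size_eq (n : ℕ) : size n = 1 + ((branches n).map size).sum := fold_eq _ n

theorem size_pos (n : ℕ) : 0 < size n := by rw [size_eq]; omega

theorem edges_eq (i j n : ℕ) : edges i j n =
    ((branches n).countP fun c => PairMatch i j (rootDeg n + 1) (rootDeg c + 1))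
      + ((branches n).map (edges i j)).sum := fold_eq _ n

theorem edges_lt_size (i j n : ℕ) : edges i j n < size n := by
  induction n using Nat.strong_induction_on with
  | _ n ih =>
    rw [edges_eq, size_eq]
    have h1 := Multiset.countP_le_card (p := fun c => PairMatch i j (rootDeg n + 1) (rootDeg c + 1))
      (s := branches n)
    have h2 : ((branches n).map fun c => 1 + edges i j c).sum ≤ ((branches n).map size).sum :=
      Multiset.sum_map_le_sum_map _ _ fun c hc => by
        have := ih c (lt_of_mem_branches hc); omega
    rw [Multiset.sum_map_add] at h2
    simp only [Multiset.map_const', Multiset.sum_replicate, smul_eq_mul, mul_one] at h2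
    omega

section Symmetric

variable {ι : Type*}

/-- The complete homogeneous symmetric function of degree `k` in the weights `w`. -/
noncomputable def hsum (w : ι → ℝ≥0∞) (k : ℕ) : ℝ≥0∞ :=
  ∑' m : Multiset ι, if Multiset.card m = k then (m.map w).prod else 0

/-- The power sum of degree `r` in the weights `w`. -/
noncomputable def psum (w : ι → ℝ≥0∞) (r : ℕ) : ℝ≥0∞ := ∑' a, w a ^ r

theorem hsum_zero (w : ι → ℝ≥0∞) : hsum w 0 = 1 := by
  rw [hsum, tsum_eq_single (0 : Multiset ι)]
  · simp
  · intro m hm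
    simp [hm]

theorem card_eq_tsum_count [DecidableEq ι] (m : Multiset ι) :
    (Multiset.card m : ℝ≥0∞) = ∑' a, (m.count a : ℝ≥0∞) := by
  rw [tsum_eq_sum (s := m.toFinset) (by simp_all)]
  exact_mod_cast (Multiset.toFinset_sum_count_eq m).symm

theorem natCast_eq_sum_range_ite {c k : ℕ} (h : c ≤ k) :
    (c : ℝ≥0∞) = ∑ r ∈ Finset.range k, if r + 1 ≤ c then 1 else 0 := by
  rw [Finset.sum_ite, Finset.sum_const_zero, add_zero, Finset.sum_const, nsmul_one]
  congr 1
  have : (Finset.range k).filter (fun r => r + 1 ≤ c) = Finset.range c := by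
    ext r; simp only [Finset.mem_filter, Finset.mem_range]; omega
  rw [this, Finset.card_range]

/-- Newton's identity between complete homogeneous symmetric functions and power sums. -/
theorem succ_mul_hsum (w : ι → ℝ≥0∞) (k : ℕ) :
    ((k + 1 : ℕ) : ℝ≥0∞) * hsum w (k + 1) =
      ∑ r ∈ Finset.range (k + 1), psum w (r + 1) * hsum w (k - r) := by
  classical
  have key : ∀ r ∈ Finset.range (k + 1), ∀ a : ι,
      (∑' m : Multiset ι, if Multiset.card m = k + 1 ∧ r + 1 ≤ m.count a
        then (m.map w).prod else 0) = w a ^ (r + 1) * hsum w (k - r) := by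
    intro r hr a
    have hr' : r ≤ k := by simpa [Nat.lt_succ_iff] using hr
    have hinj : Function.Injective fun m : Multiset ι => m + Multiset.replicate (r + 1) a :=
      fun m m' h => by simpa using h
    rw [← hinj.tsum_eq, hsum, ← ENNReal.tsum_mul_left]
    · refine tsum_congr fun m => ?_
      have h1 : (Multiset.card m + (r + 1) = k + 1) ↔ Multiset.card m = k - r := by omega
      simp only [Multiset.card_add, Multiset.card_replicate, h1, Multiset.count_add,
        Multiset.count_replicate_self, Multiset.map_add, Multiset.prod_add,
        Multiset.map_replicate, Multiset.prod_replicate]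
      simp [mul_comm]
    · intro m hm
      simp only [Function.mem_support, ne_eq, ite_eq_right_iff, not_forall] at hm
      obtain ⟨⟨-, h⟩, -⟩ := hm
      exact ⟨m - Multiset.replicate (r + 1) a,
        tsub_add_cancel_of_le (Multiset.le_count_iff_replicate_le.1 h)⟩
  have h1 : ∀ r ∈ Finset.range (k + 1), psum w (r + 1) * hsum w (k - r)
      = ∑' (m : Multiset ι) (a : ι), if Multiset.card m = k + 1 ∧ r + 1 ≤ m.count a
        then (m.map w).prod else 0 := by
    intro r hr
    rw [psum, ← ENNReal.tsum_mul_right, ENNReal.tsum_comm]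
    exact tsum_congr fun a => (key r hr a).symm
  rw [Finset.sum_congr rfl h1, hsum, ← ENNReal.tsum_mul_left,
    ← Summable.tsum_finsetSum fun _ _ => ENNReal.summable]
  refine tsum_congr fun m => ?_
  rw [← Summable.tsum_finsetSum fun _ _ => ENNReal.summable]
  by_cases hm : Multiset.card m = k + 1
  · simp only [hm, if_true, true_and]
    rw [← hm, card_eq_tsum_count, ← ENNReal.tsum_mul_right]
    refine tsum_congr fun a => ?_
    rw [natCast_eq_sum_range_ite (Multiset.count_le_card a m), Finset.sum_mul]
    exact Finset.sum_congr rfl fun r _ => by split_ifs <;> simp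
  · simp [hm]

end Symmetric

/-- The polynomial expressing complete homogeneous symmetric functions through power sums. -/
noncomputable def newton (s : ℕ → ℝ) : ℕ → ℝ
  | 0 => 1
  | k + 1 => (∑ r : Fin (k + 1), s (r + 1) * newton s (k - r)) / (k + 1)

theorem newton_zero (s : ℕ → ℝ) : newton s 0 = 1 := by rw [newton]

theorem newton_succ (s : ℕ → ℝ) (k : ℕ) : newton s (k + 1) =
    (∑ r ∈ Finset.range (k + 1), s (r + 1) * newton s (k - r)) / (k + 1) := by
  rw [newton, Finset.sum_range]

theorem newton_nonneg {s : ℕ → ℝ} (hs : ∀ r, 0 ≤ s (r + 1)) (k : ℕ) : 0 ≤ newton s k := by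
  induction k using Nat.strong_induction_on with
  | _ k ih =>
    cases k with
    | zero => simp [newton_zero]
    | succ k =>
      rw [newton_succ]
      exact div_nonneg (Finset.sum_nonneg fun r _ => mul_nonneg (hs r) (ih _ (by omega)))
        (by positivity)

theorem newton_mono {s s' : ℕ → ℝ} (hs : ∀ r, 0 ≤ s (r + 1)) (h : ∀ r, s (r + 1) ≤ s' (r + 1))
    (k : ℕ) : newton s k ≤ newton s' k := by
  induction k using Nat.strong_induction_on with
  | _ k ih =>
    cases k with
    | zero => simp [newton_zero]
    | succ k =>
      rw [newton_succ, newton_succ]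
      refine div_le_div_of_nonneg_right (Finset.sum_le_sum fun r _ => ?_) (by positivity)
      exact mul_le_mul (h r) (ih _ (by omega)) (newton_nonneg hs _) ((hs r).trans (h r))

theorem newton_one (k : ℕ) : newton (fun _ => 1) k = 1 := by
  induction k using Nat.strong_induction_on with
  | _ k ih =>
    cases k with
    | zero => simp [newton_zero]
    | succ k =>
      rw [newton_succ, Finset.sum_congr rfl fun r _ => by rw [ih (k - r) (by omega)]]
      have : (k : ℝ) + 1 ≠ 0 := by positivity
      simp [this]

theorem hsum_eq_newton {ι : Type*} {w : ι → ℝ≥0∞} (hw : ∀ r, psum w (r + 1) ≠ ⊤) (k : ℕ) :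
    hsum w k = ENNReal.ofReal (newton (fun r => (psum w r).toReal) k) := by
  induction k using Nat.strong_induction_on with
  | _ k ih =>
    cases k with
    | zero => simp [newton_zero, hsum_zero]
    | succ k =>
      have hk : ((k + 1 : ℕ) : ℝ≥0∞) ≠ 0 := by simp
      have h := succ_mul_hsum w k
      rw [Finset.sum_congr rfl fun r _ => by rw [ih (k - r) (by omega)]] at h
      rw [newton_succ, ENNReal.ofReal_div_of_pos (by positivity),
        ENNReal.eq_div_iff (by simp; positivity) (by simp), ENNReal.ofReal_sum_of_nonneg
        fun r _ => mul_nonneg ENNReal.toReal_nonneg (newton_nonneg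
          (fun _ => ENNReal.toReal_nonneg) _)]
      convert h using 1
      · congr 1
        rw [← ENNReal.ofReal_natCast]; push_cast; rfl
      · refine Finset.sum_congr rfl fun r _ => ?_
        rw [ENNReal.ofReal_mul ENNReal.toReal_nonneg, ENNReal.ofReal_toReal (hw r)]

theorem hsum_le_newton {ι : Type*} {w : ι → ℝ≥0∞} {s : ℕ → ℝ} (hs : ∀ r, 0 ≤ s (r + 1))
    (hw : ∀ r, psum w (r + 1) ≤ ENNReal.ofReal (s (r + 1))) (k : ℕ) :
    hsum w k ≤ ENNReal.ofReal (newton s k) := by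
  rw [hsum_eq_newton fun r => ((hw r).trans_lt ENNReal.ofReal_lt_top).ne]
  exact ENNReal.ofReal_le_ofReal <| newton_mono (fun _ => ENNReal.toReal_nonneg)
    (fun r => ENNReal.toReal_le_of_le_ofReal (hs r) (hw r)) k

/-- The derivative of `newton` at `s` in the direction `d`. -/
noncomputable def newtonDeriv (s d : ℕ → ℝ) : ℕ → ℝ
  | 0 => 0
  | k + 1 => (∑ r : Fin (k + 1),
      (d (r + 1) * newton s (k - r) + s (r + 1) * newtonDeriv s d (k - r))) / (k + 1)

theorem newtonDeriv_zero (s d : ℕ → ℝ) : newtonDeriv s d 0 = 0 := by rw [newtonDeriv]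

theorem newtonDeriv_succ (s d : ℕ → ℝ) (k : ℕ) : newtonDeriv s d (k + 1) =
    (∑ r ∈ Finset.range (k + 1),
      (d (r + 1) * newton s (k - r) + s (r + 1) * newtonDeriv s d (k - r))) / (k + 1) := by
  rw [newtonDeriv, Finset.sum_range
    (fun r => d (r + 1) * newton s (k - r) + s (r + 1) * newtonDeriv s d (k - r))]

theorem newtonDeriv_nonneg {s d : ℕ → ℝ} (hs : ∀ r, 0 ≤ s (r + 1)) (hd : ∀ r, 0 ≤ d (r + 1))
    (k : ℕ) : 0 ≤ newtonDeriv s d k := by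
  induction k using Nat.strong_induction_on with
  | _ k ih =>
    cases k with
    | zero => simp [newtonDeriv_zero]
    | succ k =>
      rw [newtonDeriv_succ]
      refine div_nonneg (Finset.sum_nonneg fun r _ => add_nonneg ?_ ?_) (by positivity)
      · exact mul_nonneg (hd r) (newton_nonneg hs _)
      · exact mul_nonneg (hs r) (ih _ (by omega))

theorem newtonDeriv_linear (s d d' : ℕ → ℝ) (x y : ℝ) (k : ℕ) :
    newtonDeriv s (fun r => x * d r + y * d' r) k =
      x * newtonDeriv s d k + y * newtonDeriv s d' k := by
  induction k using Nat.strong_induction_on with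
  | _ k ih =>
    cases k with
    | zero => simp [newtonDeriv_zero]
    | succ k =>
      rw [newtonDeriv_succ, newtonDeriv_succ, newtonDeriv_succ,
        Finset.sum_congr rfl fun r _ => by rw [ih (k - r) (by omega)], ← mul_div_assoc,
        ← mul_div_assoc, ← add_div, Finset.mul_sum, Finset.mul_sum, ← Finset.sum_add_distrib]
      congr 1
      exact Finset.sum_congr rfl fun r _ => by ring

theorem hasDerivAt_newton {s : ℝ → ℕ → ℝ} {d : ℕ → ℝ} {t : ℝ}
    (hs : ∀ r, HasDerivAt (fun t => s t (r + 1)) (d (r + 1)) t) (k : ℕ) :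
    HasDerivAt (fun t => newton (s t) k) (newtonDeriv (s t) d k) t := by
  induction k using Nat.strong_induction_on with
  | _ k ih =>
    cases k with
    | zero => simpa [newton_zero, newtonDeriv_zero] using hasDerivAt_const t (1 : ℝ)
    | succ k =>
      simp only [newton_succ, newtonDeriv_succ]
      refine HasDerivAt.div_const ?_ _
      exact HasDerivAt.fun_sum fun r _ => (hs r).mul (ih _ (by omega))

/-- A rooted tree structure on `V`: a root, and a parent map on the other vertices which
decreases the level. The value of `par` at the root is irrelevant. -/
structure Rooting (V : Type*) where
  /-- The root. -/
  root : V
  /-- The parent of a vertex. -/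
  par : V → V
  /-- The level of a vertex. -/
  lev : V → ℕ
  lev_root : lev root = 0
  lev_par : ∀ v, v ≠ root → lev v = lev (par v) + 1

namespace Rooting

variable {V W : Type*} (S : Rooting V)

/-- `w` is a child of `v`. -/
def IsChild (v w : V) : Prop := w ≠ S.root ∧ S.par w = v

theorem IsChild.lev_eq {S : Rooting V} {v w : V} (h : S.IsChild v w) : S.lev w = S.lev v + 1 := by
  rw [S.lev_par w h.1, h.2]

/-- The underlying graph. -/
def graph : SimpleGraph V where
  Adj v w := S.IsChild v w ∨ S.IsChild w v
  symm := ⟨fun _ _ h => h.symm⟩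
  loopless := ⟨fun v h => by have := (or_self_iff.1 h).lev_eq; omega⟩

theorem graph_adj {v w : V} : S.graph.Adj v w ↔ S.IsChild v w ∨ S.IsChild w v := Iff.rfl

theorem connected_graph : S.graph.Connected := by
  have h : ∀ n v, S.lev v = n → S.graph.Reachable v S.root := by
    intro n
    induction n using Nat.strong_induction_on with
    | _ n ih =>
      intro v hv
      by_cases hr : v = S.root
      · rw [hr]
      · have h1 := S.lev_par v hr
        exact (SimpleGraph.Adj.reachable (G := S.graph) (Or.inr ⟨hr, rfl⟩)).trans
          (ih (S.lev (S.par v)) (by omega) _ rfl)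
  have : Nonempty V := ⟨S.root⟩
  exact ⟨fun v w => (h _ v rfl).trans (h _ w rfl).symm⟩

/-- Every edge joins exactly one non-root vertex to its parent. -/
noncomputable def edgeEquiv : {w : V // w ≠ S.root} ≃ S.graph.edgeSet :=
  Equiv.ofBijective (fun w => ⟨s(S.par w, w), Or.inl ⟨w.2, rfl⟩⟩) <| by
    constructor
    · rintro ⟨v, hv⟩ ⟨w, hw⟩ h
      simp only [Subtype.mk.injEq] at h ⊢
      rcases Sym2.eq_iff.1 (congrArg Subtype.val h) with h | h
      · exact h.2
      · have h1 := S.lev_par v hv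
        have h2 := S.lev_par w hw
        rw [h.1] at h1
        rw [← h.2] at h2
        omega
    · rintro ⟨e, he⟩
      induction e using Sym2.ind with
      | _ v w =>
        rcases he with h | h
        · exact ⟨⟨w, h.1⟩, by simp [h.2]⟩
        · exact ⟨⟨v, h.1⟩, by simp [h.2, Sym2.eq_swap]⟩

theorem isTree_graph [Finite V] : S.graph.IsTree := by
  classical
  have := Fintype.ofFinite V
  rw [SimpleGraph.isTree_iff_connected_and_card, ← Nat.card_congr S.edgeEquiv]
  refine ⟨S.connected_graph, ?_⟩
  have h : 0 < Fintype.card V := Fintype.card_pos_iff.2 ⟨S.root⟩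
  simp only [ne_eq, Nat.card_eq_fintype_card, Fintype.card_subtype_compl,
    Fintype.card_subtype_eq]
  omega

/-- A finite tree can be rooted at any vertex. -/
theorem exists_graph_eq {G : SimpleGraph V} (hG : G.IsTree) (r : V) :
    ∃ S : Rooting V, S.graph = G ∧ S.root = r := by
  have h : ∀ v, ∃ u, v ≠ r → G.Adj u v ∧ G.dist r v = G.dist r u + 1 := by
    intro v
    by_cases hv : v = r
    · exact ⟨v, fun h => (h hv).elim⟩
    obtain ⟨p, hp⟩ := (hG.connected r v).exists_walk_length_eq_dist
    have hnil : ¬ p.Nil := fun h => hv h.eq.symm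
    refine ⟨p.penultimate, fun _ => ⟨p.adj_penultimate hnil, ?_⟩⟩
    have h1 := SimpleGraph.dist_le p.dropLast
    have h2 : p.dropLast.length + 1 = p.length := by
      have := SimpleGraph.Walk.not_nil_iff_lt_length.1 hnil
      simp; omega
    have h3 := (p.adj_penultimate hnil).diff_dist_adj (u := r)
    have h4 := hG.connected.dist_triangle (u := r) (v := p.penultimate) (w := v)
    have h5 := SimpleGraph.dist_eq_one_iff_adj.2 (p.adj_penultimate hnil)
    omega
  choose par hpar using h
  let S : Rooting V := ⟨r, par, G.dist r, SimpleGraph.dist_self, fun v hv => (hpar v hv).2⟩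
  refine ⟨S, ?_, rfl⟩
  have hle : S.graph ≤ G := by
    intro v w h
    rcases h with ⟨h, rfl⟩ | ⟨h, rfl⟩
    · exact (hpar w h).1
    · exact (hpar v h).1.symm
  exact le_antisymm hle
    ((SimpleGraph.isTree_iff_minimal_connected.1 hG).2 S.connected_graph hle)

end Rooting

namespace Rooting

section

variable {V W : Type*} {S : Rooting V} {S' : Rooting W}

theorem isChild_iso (φ : S.graph ≃g S'.graph) (hφ : φ S.root = S'.root) {v w : V}
    (h : S.IsChild v w) : S'.IsChild (φ v) (φ w) := by
  induction hn : S.lev w using Nat.strong_induction_on generalizing v w with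
  | _ n ih =>
    rcases φ.map_adj_iff.2 (S.graph_adj.2 (Or.inl h)) with h' | h'
    · exact h'
    · have hv : v ≠ S.root := fun hv => h'.1 (by rw [hv, hφ])
      have hl := h.lev_eq
      have hl' := S.lev_par v hv
      have h2 := ih (S.lev v) (by omega) (v := S.par v) (w := v) ⟨hv, rfl⟩ rfl
      have h3 : φ w = φ (S.par v) := by rw [← h'.2, h2.2]
      have := φ.injective h3
      subst this
      omega

theorem isChild_iso_iff (φ : S.graph ≃g S'.graph) (hφ : φ S.root = S'.root) {v w : V} :
    S'.IsChild (φ v) (φ w) ↔ S.IsChild v w := by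
  refine ⟨fun h => ?_, isChild_iso φ hφ⟩
  have := isChild_iso φ.symm (by rw [← hφ]; simp) h
  simpa using this

/-- Equal multisets of labels are matched by an injection. -/
theorem exists_injOn_of_map_eq [Nonempty W] {c : V → ℕ} {c' : W → ℕ} {s : Finset V} {t : Finset W}
    (h : s.val.map c = t.val.map c') :
    ∃ f : V → W, (∀ v ∈ s, f v ∈ t ∧ c' (f v) = c v) ∧ Set.InjOn f s := by
  classical
  induction s using Finset.induction_on generalizing t with
  | empty => exact ⟨fun _ => Classical.arbitrary W, by simp, by simp⟩
  | insert a s ha ih =>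
    rw [Finset.insert_val_of_notMem ha, Multiset.map_cons] at h
    obtain ⟨b, hb, hab⟩ := Multiset.mem_map.1 (h ▸ Multiset.mem_cons_self (c a) (s.val.map c))
    rw [← Multiset.cons_erase hb, Multiset.map_cons, hab, Multiset.cons_inj_right] at h
    obtain ⟨f, hf, hinj⟩ := ih (t := t.erase b) (by rw [Finset.erase_val]; exact h)
    have hne : ∀ v ∈ s, v ≠ a := fun v hv e => ha (e ▸ hv)
    refine ⟨Function.update f a b, ?_, ?_⟩
    · intro v hv
      rcases Finset.mem_insert.1 hv with rfl | hv
      · simpa using ⟨hb, hab⟩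
      · rw [Function.update_of_ne (hne v hv)]
        exact ⟨Finset.mem_of_mem_erase (hf v hv).1, (hf v hv).2⟩
    · rw [Finset.coe_insert, Set.injOn_insert (by exact_mod_cast ha)]
      refine ⟨hinj.congr fun v hv => (Function.update_of_ne (hne v hv) _ _).symm, ?_⟩
      rintro ⟨v, hv, hv'⟩
      rw [Function.update_of_ne (hne v hv), Function.update_self] at hv'
      exact Finset.ne_of_mem_erase (hf v hv).1 hv'

open scoped Classical in
/-- Recursion from the root to the leaves. -/
noncomputable def recParent (S : Rooting V) (a : W) (f : V → W → W) (w : V) : W :=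
  if _h : w = S.root then a else f w (recParent S a f (S.par w))
termination_by S.lev w
decreasing_by have := S.lev_par w _h; omega

theorem exists_recParent (S : Rooting V) (a : W) (f : V → W → W) :
    ∃ φ : V → W, φ S.root = a ∧ ∀ w, w ≠ S.root → φ w = f w (φ (S.par w)) :=
  ⟨S.recParent a f, by rw [recParent]; simp, fun w hw => by rw [recParent]; simp [hw]⟩

/-- Transport of a rooting along an equivalence. -/
def map (S : Rooting V) (e : V ≃ W) : Rooting W where
  root := e S.root
  par w := e (S.par (e.symm w))
  lev w := S.lev (e.symm w)
  lev_root := by rw [Equiv.symm_apply_apply, S.lev_root]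
  lev_par w hw := by
    rw [Equiv.symm_apply_apply]
    exact S.lev_par _ fun h => hw (by rw [← h, Equiv.apply_symm_apply])

theorem isChild_map (e : V ≃ W) {v w : W} :
    (S.map e).IsChild v w ↔ S.IsChild (e.symm v) (e.symm w) := by
  simp only [IsChild, map, ne_eq, Equiv.symm_apply_eq, Equiv.eq_symm_apply]

end

section

variable {V W : Type*} [Fintype V] [Fintype W] (S : Rooting V) (S' : Rooting W)

open scoped Classical in
/-- The children of a vertex. -/
noncomputable def kids (v : V) : Finset V := Finset.univ.filter (S.IsChild v)

theorem mem_kids {S : Rooting V} {v w : V} : w ∈ S.kids v ↔ S.IsChild v w := by simp [kids]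

/-- The labelling `c` sends every vertex to the code of its subtree. -/
def IsCode (c : V → ℕ) : Prop := ∀ v, branches (c v) = (S.kids v).val.map c

/-- The code of the subtree at `v`. -/
noncomputable def code (v : V) : ℕ :=
  branches.symm ((S.kids v).attach.val.map fun w => code w.1)
termination_by Finset.univ.sup S.lev - S.lev v
decreasing_by
  have h1 := (mem_kids.1 w.2).lev_eq
  have h2 : S.lev w.1 ≤ Finset.univ.sup S.lev := Finset.le_sup (Finset.mem_univ _)
  omega

theorem isCode_code : S.IsCode S.code := by
  intro v
  rw [code, Equiv.apply_symm_apply]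
  exact Multiset.attach_map_val' _ S.code

variable {S S'}

theorem IsCode.rootDeg_eq {c : V → ℕ} (hc : S.IsCode c) (v : V) :
    rootDeg (c v) = (S.kids v).card := by
  rw [rootDeg, hc v, Multiset.card_map]; rfl

/-- Summing over all pairs of a vertex and a child is summing over the non-root vertices. -/
theorem sum_sum_kids {M : Type*} [AddCommMonoid M] [DecidableEq V] (f : V → V → M) :
    ∑ v, ∑ w ∈ S.kids v, f v w = ∑ w ∈ Finset.univ.erase S.root, f (S.par w) w := by
  rw [Finset.sum_sigma']
  refine Finset.sum_bij' (fun x _ => x.2) (fun w _ => ⟨S.par w, w⟩) ?_ ?_ ?_ ?_ ?_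
  · rintro ⟨v, w⟩ h
    simp only [Finset.mem_sigma, mem_kids] at h
    simpa using h.2.1
  · intro w hw
    simp only [Finset.mem_sigma, mem_kids]
    exact ⟨Finset.mem_univ _, Finset.ne_of_mem_erase hw, rfl⟩
  · rintro ⟨v, w⟩ h
    simp only [Finset.mem_sigma, mem_kids] at h
    simp [h.2.2]
  · intro w hw
    rfl
  · rintro ⟨v, w⟩ h
    simp only [Finset.mem_sigma, mem_kids] at h
    simp [h.2.2]

theorem IsCode.fold_root {c : V → ℕ} (hc : S.IsCode c) (g : ℕ → ℕ) :
    fold g (c S.root) = ∑ v, g (c v) := by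
  classical
  have h1 : ∑ v, fold g (c v) = ∑ v, g (c v) + ∑ v, ∑ w ∈ S.kids v, fold g (c w) := by
    rw [← Finset.sum_add_distrib]
    refine Finset.sum_congr rfl fun v _ => ?_
    rw [fold_eq, hc v, Multiset.map_map]
    rfl
  rw [sum_sum_kids, ← Finset.add_sum_erase _ _ (Finset.mem_univ S.root)] at h1
  omega

theorem IsCode.size_root {c : V → ℕ} (hc : S.IsCode c) : size (c S.root) = Fintype.card V := by
  rw [size, hc.fold_root]; simp

theorem IsCode.map_iso {c : V → ℕ} {c' : W → ℕ} (hc : S.IsCode c) (hc' : S'.IsCode c')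
    (φ : S.graph ≃g S'.graph) (hφ : φ S.root = S'.root) (v : V) : c' (φ v) = c v := by
  induction hn : c v using Nat.strong_induction_on generalizing v with
  | _ n ih =>
    subst hn
    apply branches.injective
    have hk : S'.kids (φ v) = (S.kids v).map φ.toEquiv.toEmbedding := by
      ext w
      obtain ⟨w, rfl⟩ := φ.surjective w
      simp only [mem_kids, isChild_iso_iff φ hφ, Finset.mem_map_equiv]
      rw [show φ.toEquiv.symm (φ w) = w from φ.toEquiv.symm_apply_apply w]
    rw [hc, hc', hk, Finset.map_val, Multiset.map_map]
    refine Multiset.map_congr rfl fun w hw => ?_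
    refine ih (c w) (lt_of_mem_branches ?_) w rfl
    rw [hc]
    exact Multiset.mem_map_of_mem _ hw

/-- Rooted trees with the same code are isomorphic. -/
theorem nonempty_iso {c : V → ℕ} {c' : W → ℕ} (hc : S.IsCode c) (hc' : S'.IsCode c')
    (h : c S.root = c' S'.root) : Nonempty (S.graph ≃g S'.graph) := by
  classical
  have : Nonempty W := ⟨S'.root⟩
  have hex : ∀ v w, ∃ f : V → W, c v = c' w →
      (∀ u, S.IsChild v u → S'.IsChild w (f u) ∧ c' (f u) = c u) ∧
        ∀ u u', S.IsChild v u → S.IsChild v u' → f u = f u' → u = u' := by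
    intro v w
    by_cases hvw : c v = c' w
    · obtain ⟨f, hf, hinj⟩ := exists_injOn_of_map_eq (s := S.kids v) (t := S'.kids w)
        (c := c) (c' := c') (by rw [← hc v, ← hc' w, hvw])
      refine ⟨f, fun _ => ⟨fun u hu => ?_, fun u u' hu hu' => ?_⟩⟩
      · simpa only [mem_kids] using hf u (mem_kids.2 hu)
      · exact hinj (mem_kids.2 hu) (mem_kids.2 hu')
    · exact ⟨fun _ => S'.root, fun h => (hvw h).elim⟩
  choose f hf using hex
  obtain ⟨φ, hroot, hpar⟩ := S.exists_recParent S'.root fun w x => f (S.par w) x w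
  have hchild : ∀ v w, S.IsChild v w → φ w = f v (φ v) w := by
    rintro v w ⟨hw, rfl⟩
    exact hpar w hw
  have hcode : ∀ n v, S.lev v = n → c' (φ v) = c v := by
    intro n
    induction n using Nat.strong_induction_on with
    | _ n ih =>
      intro v hv
      by_cases hr : v = S.root
      · rw [hr, hroot, h]
      · have hl := S.lev_par v hr
        have hp : S.IsChild (S.par v) v := ⟨hr, rfl⟩
        rw [hchild _ _ hp]
        exact ((hf _ _ (ih (S.lev (S.par v)) (by omega) _ rfl).symm).1 v hp).2
  have hφc : ∀ v w, S.IsChild v w → S'.IsChild (φ v) (φ w) := fun v w hvw => by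
    rw [hchild v w hvw]
    exact ((hf _ _ (hcode _ v rfl).symm).1 w hvw).1
  have hinj : ∀ n v w, S.lev v = n → φ v = φ w → v = w := by
    intro n
    induction n using Nat.strong_induction_on with
    | _ n ih =>
      intro v w hv hvw
      by_cases hr : v = S.root
      · by_cases hr' : w = S.root
        · rw [hr, hr']
        · have := hφc _ _ ⟨hr', rfl⟩
          rw [← hvw, hr, hroot] at this
          exact (this.1 rfl).elim
      · by_cases hr' : w = S.root
        · have := hφc _ _ ⟨hr, rfl⟩
          rw [hvw, hr', hroot] at this
          exact (this.1 rfl).elim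
        · have h1 := hφc _ _ ⟨hr, rfl⟩
          have h2 := hφc _ _ ⟨hr', rfl⟩
          have hl := S.lev_par v hr
          have hpar : S.par v = S.par w := ih (S.lev (S.par v)) (by omega) _ _ rfl
            (by rw [← h1.2, ← h2.2, hvw])
          refine (hf _ _ (hcode _ (S.par v) rfl).symm).2 v w ⟨hr, rfl⟩ ⟨hr', hpar.symm⟩ ?_
          rw [← hchild _ _ ⟨hr, rfl⟩, ← hchild _ _ ⟨hr', hpar.symm⟩, hvw]
  have hcard : Fintype.card V = Fintype.card W := by rw [← hc.size_root, ← hc'.size_root, h]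
  have hbij : Function.Bijective φ :=
    (Fintype.bijective_iff_injective_and_card φ).2 ⟨fun v w => hinj _ v w rfl, hcard⟩
  have hrev : ∀ v w, S'.IsChild (φ v) (φ w) → S.IsChild v w := by
    intro v w hvw
    have hr : w ≠ S.root := fun e => hvw.1 (by rw [e, hroot])
    refine ⟨hr, hbij.1 ?_⟩
    rw [← (hφc _ _ ⟨hr, rfl⟩).2, hvw.2]
  refine ⟨⟨Equiv.ofBijective φ hbij, ?_⟩⟩
  intro v w
  exact ⟨Or.imp (hrev v w) (hrev w v), Or.imp (hφc v w) (hφc w v)⟩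

theorem IsCode.map {c : V → ℕ} (hc : S.IsCode c) (e : V ≃ W) :
    (S.map e).IsCode fun w => c (e.symm w) := by
  intro w
  have hk : (S.map e).kids w = (S.kids (e.symm w)).map e.toEmbedding := by
    ext u
    simp [mem_kids, isChild_map, Finset.mem_map_equiv]
  simp only
  rw [hk, hc, Finset.map_val, Multiset.map_map]
  exact Multiset.map_congr rfl fun u _ => by simp

end

/-- Every natural number is the code of a rooted tree. -/
theorem exists_isCode (T : ℕ) : ∃ (S : Rooting (Fin (size T))) (c : Fin (size T) → ℕ),
    S.IsCode c ∧ c S.root = T := by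
  suffices h : ∃ (V : Type) (_ : Fintype V) (S : Rooting V) (c : V → ℕ),
      S.IsCode c ∧ c S.root = T by
    obtain ⟨V, _, S, c, hc, rfl⟩ := h
    refine ⟨S.map (Fintype.equivFinOfCardEq hc.size_root.symm), _, hc.map _, ?_⟩
    simp [Rooting.map]
  induction T using Nat.strong_induction_on with
  | _ T ih =>
    classical
    let l := (branches T).toList
    have hl : ∀ i : Fin l.length, l.get i < T := fun i =>
      lt_of_mem_branches (Multiset.mem_toList.1 (l.get_mem i))
    choose V hV S c hc hroot using fun i => ih (l.get i) (hl i)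
    let S₀ : Rooting (Option (Σ i, V i)) :=
      { root := none
        par := fun x => x.elim none fun x =>
          if x.2 = (S x.1).root then none else some ⟨x.1, (S x.1).par x.2⟩
        lev := fun x => x.elim 0 fun x => (S x.1).lev x.2 + 1
        lev_root := rfl
        lev_par := by
          rintro (_ | ⟨i, v⟩) hv
          · exact (hv rfl).elim
          · by_cases h : v = (S i).root
            · simp [h, (S i).lev_root]
            · simp [h, (S i).lev_par v h] }
    refine ⟨_, inferInstance, S₀, fun x => x.elim T fun x => c x.1 x.2, ?_, rfl⟩
    rintro (_ | ⟨i, v⟩)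
    · have hk : S₀.kids none = Finset.univ.image fun i => some ⟨i, (S i).root⟩ := by
        ext x
        rcases x with _ | ⟨i, v⟩
        · simp [mem_kids, IsChild, S₀]
        · by_cases h : v = (S i).root
          · subst h
            simp [mem_kids, IsChild, S₀]
          · simp only [mem_kids, IsChild, S₀, h, Option.elim, if_false, Finset.mem_image,
              Option.some.injEq, reduceCtorEq, and_false, Finset.mem_univ, true_and, false_iff]
            rintro ⟨j, hj⟩
            cases hj
            exact h rfl
      rw [hk, Finset.image_val_of_injOn
        (fun i _ j _ h => congrArg Sigma.fst (Option.some.inj h)), Multiset.map_map]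
      have h2 : ((Finset.univ : Finset (Fin l.length)).val.map l.get) = branches T := by
        rw [Fin.univ_val_map, List.ofFn_get, Multiset.coe_toList]
      refine h2.symm.trans (Multiset.map_congr rfl fun i _ => ?_)
      exact (hroot i).symm
    · have hk : S₀.kids (some ⟨i, v⟩) = ((S i).kids v).image fun w => some ⟨i, w⟩ := by
        ext x
        rcases x with _ | ⟨j, w⟩
        · simp [mem_kids, IsChild, S₀]
        · simp only [mem_kids, IsChild, S₀, Option.elim, Finset.mem_image,
            Option.some.injEq, ne_eq, reduceCtorEq, not_false_eq_true, true_and]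
          constructor
          · intro h
            by_cases hw : w = (S j).root
            · simp [hw] at h
            · rw [if_neg hw] at h
              cases h
              exact ⟨w, ⟨hw, rfl⟩, rfl⟩
          · rintro ⟨u, ⟨hu, rfl⟩, h⟩
            cases h
            rw [if_neg hu]
      rw [hk, Finset.image_val_of_injOn
        (fun u _ u' _ h => by simpa using h), Multiset.map_map]
      exact hc i v

end Rooting

namespace Rooting

variable {n : ℕ} {S : Rooting (Fin n)} {c : Fin n → ℕ}

theorem IsCode.degr_graph (hc : S.IsCode c) (v : Fin n) :
    degr S.graph v = rootDeg (c v) + if v = S.root then 0 else 1 := by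
  classical
  have h : ∀ u, S.graph.Adj v u ↔
      u ∈ S.kids v ∪ if v = S.root then ∅ else {S.par v} := by
    intro u
    by_cases hv : v = S.root
    · simp [graph_adj, mem_kids, IsChild, hv]
    · simp [graph_adj, mem_kids, IsChild, hv, eq_comm, or_comm]
  rw [degr, Nat.card_congr (Equiv.subtypeEquivRight h), Nat.card_eq_fintype_card,
    Fintype.card_coe, hc.rootDeg_eq]
  by_cases hv : v = S.root
  · simp [hv]
  · rw [if_neg hv, if_neg hv, Finset.card_union_of_disjoint, Finset.card_singleton]
    rw [Finset.disjoint_singleton_right, mem_kids]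
    intro h
    have := h.lev_eq
    have := S.lev_par v hv
    omega

theorem ecount_graph (S : Rooting (Fin n)) (i j : ℕ) : ecount i j S.graph =
    ∑ w ∈ Finset.univ.erase S.root,
      if PairMatch i j (degr S.graph (S.par w)) (degr S.graph w) then 1 else 0 := by
  classical
  have h : ∀ w : {w : Fin n // w ≠ S.root},
      PairMatch i j (degr S.graph (S.par w)) (degr S.graph w) ↔
      ∃ u v : Fin n, (S.edgeEquiv w : Sym2 (Fin n)) = s(u, v) ∧
        degr S.graph u = i ∧ degr S.graph v = j := by
    intro w
    have he : (S.edgeEquiv w : Sym2 (Fin n)) = s(S.par w, w.1) := rfl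
    rw [he]
    constructor
    · rintro (h | h)
      · exact ⟨_, _, rfl, h⟩
      · exact ⟨_, _, Sym2.eq_swap, h.symm⟩
    · rintro ⟨u, v, huv, h⟩
      rcases Sym2.eq_iff.1 huv with ⟨h1, h2⟩ | ⟨h1, h2⟩
      · rw [h1, h2]; exact Or.inl h
      · rw [h1, h2]; exact Or.inr h.symm
  rw [ecount, ← Nat.card_congr (S.edgeEquiv.subtypeEquiv h), ← Finset.card_filter,
    Nat.card_congr (Equiv.subtypeSubtypeEquivSubtypeInter (fun w => w ≠ S.root)
      (fun w => PairMatch i j (degr S.graph (S.par w)) (degr S.graph w)))]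
  exact Nat.subtype_card _ (by simp)

theorem IsCode.edges_root (hc : S.IsCode c) (i j : ℕ) : edges i j (c S.root) =
    ∑ w ∈ Finset.univ.erase S.root,
      if PairMatch i j (rootDeg (c (S.par w)) + 1) (rootDeg (c w) + 1) then 1 else 0 := by
  rw [edges, hc.fold_root, ← sum_sum_kids (S := S) fun v w =>
    if PairMatch i j (rootDeg (c v) + 1) (rootDeg (c w) + 1) then 1 else 0]
  refine Finset.sum_congr rfl fun v _ => ?_
  rw [hc v, Multiset.countP_map, ← Finset.card_filter]
  rfl

theorem IsCode.bounded_root_iff (hc : S.IsCode c) {Δ : ℕ} :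
    Bounded Δ (c S.root) ↔ ∀ v, rootDeg (c v) < Δ := by
  rw [Bounded, hc.fold_root]
  simp

end Rooting

theorem exists_code_of_class {Δ n : ℕ} (hΔ : 3 ≤ Δ) (hn : 2 ≤ n) (i j : ℕ) :
    ∃ τ : TClass Δ n → ℕ, Function.Injective τ ∧ ∀ q, Bounded Δ (τ q) ∧ size (τ q) = n ∧
      Yedge Δ n i j q ≤ edges i j (τ q) + 1 ∧ edges i j (τ q) ≤ Yedge Δ n i j q + 1 := by
  classical
  have : Nontrivial (Fin n) := Fin.nontrivial_iff_two_le.2 hn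
  have h : ∀ q : TClass Δ n, ∃ S : Rooting (Fin n), S.graph = q.out.1 ∧
      degr q.out.1 S.root = 1 := by
    intro q
    obtain ⟨r, hr⟩ := q.out.2.1.exists_vert_degree_one_of_nontrivial
    obtain ⟨S, hS, hSr⟩ := Rooting.exists_graph_eq q.out.2.1 r
    refine ⟨S, hS, ?_⟩
    rw [hSr, ← hr, degr, Nat.card_eq_fintype_card, ← SimpleGraph.card_neighborSet_eq_degree]
    rfl
  choose S hS hr using h
  refine ⟨fun q => (S q).code (S q).root, ?_, ?_⟩
  · intro q q' h
    obtain ⟨e⟩ := Rooting.nonempty_iso (S q).isCode_code (S q').isCode_code h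
    rw [hS, hS] at e
    exact Quotient.out_equiv_out.1 ⟨e⟩
  · intro q
    have hc := (S q).isCode_code
    have hdeg := hc.degr_graph
    have hle := q.out.2.2
    have hr := hr q
    rw [← hS] at hr hle
    have hr' : rootDeg ((S q).code (S q).root) = 1 := by simpa [hdeg] using hr
    refine ⟨hc.bounded_root_iff.2 fun v => ?_, by simpa using hc.size_root, ?_⟩
    · by_cases hv : v = (S q).root
      · rw [hv, hr']; omega
      · have := hle v
        rw [hdeg, if_neg hv] at this
        omega
    · have hone : ∑ w ∈ Finset.univ.erase (S q).root,
          (if (S q).par w = (S q).root then 1 else 0) = 1 := by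
        rw [← Rooting.sum_sum_kids (S := S q) fun v _ => if v = (S q).root then 1 else 0]
        simp only [Finset.sum_const, smul_eq_mul, mul_ite, mul_one, mul_zero,
          Finset.sum_ite_eq', Finset.mem_univ, if_true]
        rw [← hc.rootDeg_eq, hr']
      have hE := (S q).ecount_graph i j
      rw [hS] at hE
      rw [Yedge, hE, hc.edges_root]
      have key : ∀ w ∈ Finset.univ.erase (S q).root, (S q).par w ≠ (S q).root →
          degr q.out.1 ((S q).par w) = rootDeg ((S q).code ((S q).par w)) + 1 ∧
          degr q.out.1 w = rootDeg ((S q).code w) + 1 := by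
        intro w hw hp
        rw [← hS, hdeg, hdeg, if_neg hp, if_neg (Finset.ne_of_mem_erase hw)]
        exact ⟨rfl, rfl⟩
      constructor <;>
      · refine le_of_le_of_eq ?_ (congrArg _ hone)
        rw [← Finset.sum_add_distrib]
        refine Finset.sum_le_sum fun w hw => ?_
        by_cases hp : (S q).par w = (S q).root
        · rw [if_pos hp]
          split_ifs <;> omega
        · rw [(key w hw hp).1, (key w hw hp).2]
          omega

theorem exists_class_of_code (Δ n : ℕ) :
    ∃ f : {T : ℕ // Bounded Δ T ∧ size T = n} → TClass Δ n × Fin n, Function.Injective f := by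
  have h : ∀ T : {T : ℕ // Bounded Δ T ∧ size T = n}, ∃ p : TClass Δ n × Fin n,
      ∃ (S : Rooting (Fin n)) (c : Fin n → ℕ) (φ : p.1.out.1 ≃g S.graph),
        S.IsCode c ∧ c S.root = T ∧ φ p.2 = S.root := by
    rintro ⟨T, hT, rfl⟩
    obtain ⟨S, c, hc, hcT⟩ := Rooting.exists_isCode T
    rw [← hcT, hc.bounded_root_iff] at hT
    let G : DTree Δ (size T) := ⟨S.graph, S.isTree_graph, fun v => by
      have := hT v
      rw [hc.degr_graph]
      split_ifs <;> omega⟩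
    obtain ⟨φ⟩ : (⟦G⟧ : TClass Δ (size T)).out ≈ G := Quotient.mk_out G
    exact ⟨(⟦G⟧, φ.symm S.root), S, c, φ, hc, hcT, φ.apply_symm_apply _⟩
  choose f hf using h
  refine ⟨f, fun T T' hTT => Subtype.ext ?_⟩
  obtain ⟨S, c, φ, hc, hcT, hφ⟩ := hf T
  have hT' := hf T'
  rw [← hTT] at hT'
  obtain ⟨S', c', φ', hc', hcT', hφ'⟩ := hT'
  have hroot : (φ.symm.trans φ') S.root = S'.root := by simp [← hφ, hφ']
  rw [← hcT, ← hcT', ← hroot, hc.map_iso hc' (φ.symm.trans φ') hroot S.root]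

/-- The weight `x ^ size * y ^ edges` of a bounded coded tree. -/
noncomputable def weight (Δ i j : ℕ) (x y : ℝ≥0∞) (T : ℕ) : ℝ≥0∞ :=
  open Classical in if Bounded Δ T then x ^ size T * y ^ edges i j T else 0

/-- The factor contributed by an edge whose endpoints have `k` and `l` branches. -/
noncomputable def edgeFactor (i j : ℕ) (y : ℝ≥0∞) (k l : ℕ) : ℝ≥0∞ :=
  if PairMatch i j (k + 1) (l + 1) then y else 1

theorem prod_map_edgeFactor (i j : ℕ) (y : ℝ≥0∞) (k : ℕ) (m : Multiset ℕ) :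
    (m.map fun c => edgeFactor i j y k (rootDeg c)).prod =
      y ^ m.countP fun c => PairMatch i j (k + 1) (rootDeg c + 1) := by
  induction m using Multiset.induction_on with
  | empty => simp
  | cons c m ih =>
    rw [Multiset.map_cons, Multiset.prod_cons, ih, Multiset.countP_cons, edgeFactor]
    split_ifs
    · rw [pow_succ, mul_comm]
    · simp

theorem weight_eq {Δ i j : ℕ} (x y : ℝ≥0∞) {T : ℕ} (hT : rootDeg T < Δ) :
    weight Δ i j x y T = x * ((branches T).map fun c =>
      weight Δ i j x y c * edgeFactor i j y (rootDeg T) (rootDeg c)).prod := by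
  classical
  rw [Multiset.prod_map_mul, prod_map_edgeFactor, weight]
  by_cases h : ∀ c ∈ branches T, Bounded Δ c
  · have : (branches T).map (weight Δ i j x y) =
        (branches T).map fun c => x ^ size c * y ^ edges i j c :=
      Multiset.map_congr rfl fun c hc => if_pos (h c hc)
    rw [if_pos (bounded_iff.2 ⟨hT, h⟩), this, Multiset.prod_map_mul, size_eq, edges_eq,
      pow_add, pow_add, pow_one]
    have hpow : ∀ (z : ℝ≥0∞) (g : ℕ → ℕ) (m : Multiset ℕ),
        z ^ (m.map g).sum = (m.map fun c => z ^ g c).prod := by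
      intro z g m
      induction m using Multiset.induction_on with
      | empty => simp
      | cons c m ih => simp [pow_add, ih]
    rw [hpow, hpow]
    ring
  · rw [if_neg fun hb => h (bounded_iff.1 hb).2]
    push Not at h
    obtain ⟨c, hc, hcb⟩ := h
    have : ((branches T).map (weight Δ i j x y)).prod = 0 :=
      Multiset.prod_eq_zero (Multiset.mem_map.2 ⟨c, hc, if_neg hcb⟩)
    rw [this]
    simp

theorem weight_eq_zero {Δ i j : ℕ} {x y : ℝ≥0∞} {T : ℕ} (hT : ¬ rootDeg T < Δ) :
    weight Δ i j x y T = 0 :=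
  if_neg fun h => hT (bounded_iff.1 h).1

/-- The functional equation for weighted coded trees with `k` branches at the root. -/
theorem tsum_weight_rootDeg {Δ i j : ℕ} (x y : ℝ≥0∞) {k : ℕ} (hk : k < Δ) :
    ∑' T, (if rootDeg T = k then weight Δ i j x y T else 0) =
      x * hsum (fun c => weight Δ i j x y c * edgeFactor i j y k (rootDeg c)) k := by
  rw [hsum, ← ENNReal.tsum_mul_left, ← branches.tsum_eq]
  refine tsum_congr fun T => ?_
  rw [← rootDeg]
  split_ifs with h
  · rw [weight_eq _ _ (h ▸ hk), h]
  · simp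

theorem tsum_weight_rootDeg_lt_le {Δ i j : ℕ} (x y : ℝ≥0∞) {k : ℕ} (hk : k < Δ) (N : ℕ) :
    ∑' T, (if rootDeg T = k ∧ T < N + 1 then weight Δ i j x y T else 0) ≤
      x * hsum (fun c => (if c < N then weight Δ i j x y c else 0) *
        edgeFactor i j y k (rootDeg c)) k := by
  rw [hsum, ← ENNReal.tsum_mul_left, ← branches.tsum_eq]
  refine ENNReal.tsum_le_tsum fun T => ?_
  rw [← rootDeg]
  split_ifs with h h' h'
  · rw [weight_eq _ _ (h.1 ▸ hk), h.1]
    refine le_of_eq (congrArg (x * ·) (congrArg _ (Multiset.map_congr rfl fun c hc => ?_)))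
    rw [if_pos (by have := lt_of_mem_branches hc; omega)]
  · exact absurd h.1 h'
  · exact zero_le
  · simp

/-- The power sums of the weights of the coded trees with `l` branches at the root. -/
noncomputable def levelSum (Δ i j : ℕ) (x y : ℝ≥0∞) (r l : ℕ) : ℝ≥0∞ :=
  ∑' T, if rootDeg T = l then weight Δ i j x y T ^ r else 0

theorem tsum_eq_sum_rootDeg {Δ : ℕ} {f : ℕ → ℝ≥0∞} (hf : ∀ T, ¬ rootDeg T < Δ → f T = 0) :
    ∑' T, f T = ∑ l ∈ Finset.range Δ, ∑' T, if rootDeg T = l then f T else 0 := by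
  rw [← Summable.tsum_finsetSum fun _ _ => ENNReal.summable]
  refine tsum_congr fun T => ?_
  rw [Finset.sum_ite_eq]
  split_ifs with h
  · rfl
  · exact hf T (by simpa using h)

theorem psum_weight {Δ i j : ℕ} (x y : ℝ≥0∞) (k : ℕ) {r : ℕ} (hr : r ≠ 0) :
    psum (fun c => weight Δ i j x y c * edgeFactor i j y k (rootDeg c)) r =
      ∑ l ∈ Finset.range Δ, edgeFactor i j y k l ^ r * levelSum Δ i j x y r l := by
  rw [psum, tsum_eq_sum_rootDeg (Δ := Δ) fun T hT => by simp [weight_eq_zero hT, hr]]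
  refine Finset.sum_congr rfl fun l _ => ?_
  rw [levelSum, ← ENNReal.tsum_mul_left]
  refine tsum_congr fun T => ?_
  split_ifs with h
  · rw [mul_pow, mul_comm, h]
  · simp

/-- A supersolution of the system of functional equations bounds the weighted sums. -/
theorem levelSum_one_le {Δ i j : ℕ} {x y : ℝ≥0∞} {s : ℕ → ℕ → ℝ} {p : ℕ → ℝ}
    (hs : ∀ k r, 0 ≤ s k r)
    (h1 : ∀ k < Δ, ∑ l ∈ Finset.range Δ, edgeFactor i j y k l * ENNReal.ofReal (p l) ≤
      ENNReal.ofReal (s k 1))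
    (h2 : ∀ k < Δ, ∀ r, ∑ l ∈ Finset.range Δ, edgeFactor i j y k l ^ (r + 2) *
      levelSum Δ i j x y (r + 2) l ≤ ENNReal.ofReal (s k (r + 2)))
    (hp : ∀ k < Δ, x * ENNReal.ofReal (newton (s k) k) ≤ ENNReal.ofReal (p k)) :
    ∀ k < Δ, levelSum Δ i j x y 1 k ≤ ENNReal.ofReal (p k) := by
  have key : ∀ N, ∀ k < Δ, ∑' T, (if rootDeg T = k ∧ T < N then weight Δ i j x y T else 0) ≤
      ENNReal.ofReal (p k) := by
    intro N
    induction N with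
    | zero => simp
    | succ N ih =>
      intro k hk
      refine (tsum_weight_rootDeg_lt_le x y hk N).trans
        ((mul_le_mul_right (hsum_le_newton (hs k <| · + 1) (fun r => ?_) k) x).trans (hp k hk))
      rw [psum, tsum_eq_sum_rootDeg (Δ := Δ) fun T hT => by simp [weight_eq_zero hT]]
      cases r with
      | zero =>
        refine le_trans (Finset.sum_le_sum fun l hl => ?_) (h1 k hk)
        refine le_trans (le_of_eq ?_) (mul_le_mul_right (ih l (Finset.mem_range.1 hl)) _)
        rw [← ENNReal.tsum_mul_left]
        refine tsum_congr fun T => ?_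
        by_cases h : rootDeg T = l <;> simp [h, mul_comm]
      | succ r =>
        refine le_trans (Finset.sum_le_sum fun l _ => ?_) (h2 k hk r)
        rw [levelSum, ← ENNReal.tsum_mul_left]
        refine ENNReal.tsum_le_tsum fun T => ?_
        by_cases h : rootDeg T = l <;> by_cases h' : T < N <;> simp [h, h', mul_comm, mul_pow]
  intro k hk
  rw [levelSum, ENNReal.tsum_eq_iSup_nat]
  refine iSup_le fun N => le_trans ?_ (key N k hk)
  refine (Finset.sum_le_sum fun T hT => ?_).trans (ENNReal.sum_le_tsum (Finset.range N))
  simp [Finset.mem_range.1 hT]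

/-- The number of bounded coded trees of a given size. -/
noncomputable def codeCount (Δ n : ℕ) : ℕ := Nat.card {T : ℕ // Bounded Δ T ∧ size T = n}

instance (Δ n : ℕ) : Finite {T : ℕ // Bounded Δ T ∧ size T = n} :=
  let ⟨_, hf⟩ := exists_class_of_code Δ n
  Finite.of_injective _ hf

theorem codeCount_le (Δ n : ℕ) : codeCount Δ n ≤ Nat.card (TClass Δ n) * n := by
  obtain ⟨f, hf⟩ := exists_class_of_code Δ n
  simpa [codeCount] using Nat.card_le_card_of_injective f hf

theorem rootDeg_symm (m : Multiset ℕ) : rootDeg (branches.symm m) = Multiset.card m := by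
  simp [rootDeg]

theorem size_symm (m : Multiset ℕ) : size (branches.symm m) = 1 + (m.map size).sum := by
  rw [size_eq, Equiv.apply_symm_apply]

theorem bounded_symm {Δ : ℕ} {m : Multiset ℕ} :
    Bounded Δ (branches.symm m) ↔ Multiset.card m < Δ ∧ ∀ c ∈ m, Bounded Δ c := by
  rw [bounded_iff, rootDeg_symm, Equiv.apply_symm_apply]

theorem codeCount_zero (Δ : ℕ) : codeCount Δ 0 = 0 := by
  have : IsEmpty {T : ℕ // Bounded Δ T ∧ size T = 0} :=
    ⟨fun T => (size_pos T.1).ne' T.2.2⟩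
  exact Nat.card_of_isEmpty

theorem codeCount_mono {Δ : ℕ} (hΔ : 3 ≤ Δ) : Monotone (codeCount Δ) := by
  refine monotone_nat_of_le_succ fun n => ?_
  refine Nat.card_le_card_of_injective
    (fun T => ⟨branches.symm {T.1}, bounded_symm.2 ⟨by simp; omega, by simp [T.2.1]⟩,
      by simp [size_symm, T.2.2, add_comm]⟩) fun T T' h => Subtype.ext ?_
  simpa using h

theorem one_le_codeCount {Δ n : ℕ} (hΔ : 3 ≤ Δ) (hn : 1 ≤ n) : 1 ≤ codeCount Δ n := by
  refine le_trans ?_ (codeCount_mono hΔ hn)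
  have : Nonempty {T : ℕ // Bounded Δ T ∧ size T = 1} :=
    ⟨⟨branches.symm 0, bounded_symm.2 ⟨by simp; omega, by simp⟩, by simp [size_symm]⟩⟩
  exact Nat.card_pos

theorem codeCount_mul_le {Δ : ℕ} (hΔ : 3 ≤ Δ) (m n : ℕ) :
    codeCount Δ m * codeCount Δ n ≤ codeCount Δ (m + n + 1) * 2 := by
  rw [codeCount, codeCount, codeCount, ← Nat.card_prod, ← Nat.card_fin 2, ← Nat.card_prod]
  classical
  refine Nat.card_le_card_of_injective (fun p => (⟨branches.symm {p.1.1, p.2.1},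
    bounded_symm.2 ⟨by simp; omega, by simp [p.1.2.1, p.2.2.1]⟩,
    by simp [size_symm, p.1.2.2, p.2.2.2]; omega⟩, if p.1.1 ≤ p.2.1 then 0 else 1)) ?_
  rintro ⟨⟨A, hA⟩, ⟨B, hB⟩⟩ ⟨⟨A', hA'⟩, ⟨B', hB'⟩⟩ h
  simp only [Prod.mk.injEq, Subtype.mk.injEq, EmbeddingLike.apply_eq_iff_eq] at h ⊢
  obtain ⟨h1, h2⟩ := h
  simp only [Multiset.insert_eq_cons] at h1
  have h3 : (A = A' ∧ B = B') ∨ (A = B' ∧ B = A') := by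
    rcases Multiset.cons_eq_cons.1 h1 with ⟨h, h'⟩ | ⟨-, c, h, h'⟩
    · exact Or.inl ⟨h, by simpa using h'⟩
    · have e1 := (Multiset.singleton_eq_cons_iff _).1 h
      have e2 := h'
      rw [e1.2] at e2
      have e2 : B' = A := by simpa using e2
      exact Or.inr ⟨e2.symm, e1.1⟩
  rcases h3 with h3 | ⟨rfl, rfl⟩
  · exact h3
  · by_cases h4 : A ≤ B <;> by_cases h5 : B ≤ A <;> simp_all
    · omega
    · omega

theorem tsum_weight_one (Δ i j : ℕ) (x : ℝ≥0∞) :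
    ∑' T, weight Δ i j x 1 T = ∑' n, codeCount Δ n * x ^ n := by
  classical
  have h : ∀ n, (codeCount Δ n : ℝ≥0∞) * x ^ n =
      ∑' T, if Bounded Δ T ∧ size T = n then x ^ n else 0 := by
    intro n
    have := tsum_subtype {T : ℕ | Bounded Δ T ∧ size T = n} fun _ => x ^ n
    simp only [Set.indicator_apply, Set.mem_ofPred_eq] at this
    have hfin : Finite {T : ℕ | Bounded Δ T ∧ size T = n} :=
      inferInstanceAs (Finite {T : ℕ // Bounded Δ T ∧ size T = n})
    rw [← this, ENNReal.tsum_const, codeCount, ENat.card_eq_coe_natCard]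
    rfl
  simp_rw [h]
  rw [ENNReal.tsum_comm]
  refine tsum_congr fun T => ?_
  rw [tsum_eq_single (size T) (by intro n hn; simp [hn.symm])]
  simp [weight]

theorem edgeFactor_one (i j k l : ℕ) : edgeFactor i j 1 k l = 1 := by simp [edgeFactor]

theorem tsum_weight_le_one {Δ : ℕ} (hΔ : Δ ≠ 0) (i j : ℕ) :
    ∑' T, weight Δ i j (Δ : ℝ≥0∞)⁻¹ 1 T ≤ 1 := by
  set x : ℝ≥0∞ := (Δ : ℝ≥0∞)⁻¹ with hx
  have key : ∀ N, ∑' T, (if T < N then weight Δ i j x 1 T else 0) ≤ 1 := by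
    intro N
    induction N with
    | zero => simp
    | succ N ih =>
      rw [tsum_eq_sum_rootDeg (Δ := Δ) fun T hT => by simp [weight_eq_zero hT]]
      have hk : ∀ k ∈ Finset.range Δ, ∑' T, (if rootDeg T = k then
          if T < N + 1 then weight Δ i j x 1 T else 0 else 0) ≤ x := by
        intro k hk
        simp_rw [← ite_and]
        refine (tsum_weight_rootDeg_lt_le x 1 (Finset.mem_range.1 hk) N).trans ?_
        refine (mul_le_mul_right
          (hsum_le_newton (s := fun _ => 1) (by simp) (fun r => ?_) k) x).trans
          (by simp [newton_one])
        simp only [edgeFactor_one, mul_one, ENNReal.ofReal_one]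
        refine le_trans (ENNReal.tsum_le_tsum fun T => ?_) ih
        exact pow_le_of_le_one zero_le ((ENNReal.le_tsum T).trans ih) (by omega)
      refine (Finset.sum_le_sum hk).trans ?_
      rw [Finset.sum_const, Finset.card_range, nsmul_eq_mul, hx,
        ENNReal.mul_inv_cancel (by simpa using hΔ) (by simp)]
  rw [ENNReal.tsum_eq_iSup_nat]
  refine iSup_le fun N => le_trans ?_ (key N)
  refine (Finset.sum_le_sum fun T hT => ?_).trans (ENNReal.sum_le_tsum (Finset.range N))
  simp [Finset.mem_range.1 hT]

theorem codeCount_le_pow {Δ : ℕ} (hΔ : Δ ≠ 0) (n : ℕ) : codeCount Δ n ≤ Δ ^ n := by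
  have h := (ENNReal.le_tsum n).trans
    ((tsum_weight_one Δ 0 0 _).symm.le.trans (tsum_weight_le_one hΔ 0 0))
  rw [← ENNReal.inv_pow, ← div_eq_mul_inv] at h
  have := (ENNReal.div_le_iff (by simp [hΔ]) (by simp)).1 h
  rw [one_mul] at this
  exact_mod_cast this

theorem mul_tsum_weight_le_two {Δ i j : ℕ} (hΔ : 3 ≤ Δ) {x : ℝ≥0∞}
    (hx : ∑' T, weight Δ i j x 1 T ≠ ⊤) : x * ∑' T, weight Δ i j x 1 T ≤ 2 := by
  set S := ∑' T, weight Δ i j x 1 T with hS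
  by_cases hS0 : S = 0
  · simp [hS0]
  have h1 : x * hsum (weight Δ i j x 1) 2 ≤ S := by
    have := tsum_weight_rootDeg (Δ := Δ) (i := i) (j := j) x 1 (k := 2) (by omega)
    simp only [edgeFactor_one, mul_one] at this
    rw [← this]
    exact ENNReal.tsum_le_tsum fun T => by split_ifs <;> simp
  have h2 : hsum (weight Δ i j x 1) 1 = S := by
    have := succ_mul_hsum (weight Δ i j x 1) 0
    simpa [hsum_zero, psum] using this
  have h3 : S * S ≤ 2 * hsum (weight Δ i j x 1) 2 := by
    have := succ_mul_hsum (weight Δ i j x 1) 1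
    simp only [Finset.sum_range_succ, Finset.sum_range_zero] at this
    norm_num at this
    rw [this, h2]
    refine le_trans (le_of_eq ?_) le_self_add
    simp [psum, hS]
  refine (ENNReal.mul_le_mul_iff_left hS0 hx).1 ?_
  calc x * S * S = x * (S * S) := mul_assoc _ _ _
    _ ≤ x * (2 * hsum (weight Δ i j x 1) 2) := by gcongr
    _ = 2 * (x * hsum (weight Δ i j x 1) 2) := by ring
    _ ≤ 2 * S := by gcongr

theorem exists_growth_rate {Δ : ℕ} (hΔ : 3 ≤ Δ) : ∃ L C : ℝ, 0 < C ∧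
    (∀ n, codeCount Δ n ≤ C * Real.exp (-L * n)) ∧
    ∀ δ > 0, ∃ c > 0, ∀ᶠ n : ℕ in atTop,
      c * Real.exp (-δ * n) ≤ codeCount Δ n * Real.exp (L * n) := by
  set b : ℕ → ℕ := fun n => max 1 (codeCount Δ (n - 1)) with hb
  have hb1 : ∀ n, 1 ≤ b n := fun n => le_max_left _ _
  have hbpos : ∀ n, (0 : ℝ) < b n := fun n => by exact_mod_cast hb1 n
  have hbmul : ∀ m n, b m * b n ≤ 2 * b (m + n) := by
    have hmono : Monotone b := fun m n h =>
      max_le_max le_rfl (codeCount_mono hΔ (Nat.sub_le_sub_right h 1))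
    have hone : ∀ m ≤ 1, b m = 1 := by
      intro m hm
      have : m - 1 = 0 := by omega
      simp [hb, this, codeCount_zero]
    intro m n
    by_cases hm : m ≤ 1
    · rw [hone m hm]
      have := hmono (show n ≤ m + n by omega)
      omega
    by_cases hn : n ≤ 1
    · rw [hone n hn]
      have := hmono (show m ≤ m + n by omega)
      omega
    have h := codeCount_mul_le hΔ (m - 1) (n - 1)
    rw [show m - 1 + (n - 1) + 1 = m + n - 1 by omega] at h
    have h' : ∀ n, 1 < n → b n = codeCount Δ (n - 1) := fun n hn =>
      max_eq_right (one_le_codeCount hΔ (by omega))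
    rw [h' m (by omega), h' n (by omega), h' (m + n) (by omega)]
    omega
  set u : ℕ → ℝ := fun n => Real.log 2 - Real.log (b n) with hu
  have hsub : Subadditive u := by
    intro m n
    have h : ((b m : ℝ) * b n) ≤ 2 * b (m + n) := by exact_mod_cast hbmul m n
    have := Real.log_le_log (mul_pos (hbpos m) (hbpos n)) h
    rw [Real.log_mul (hbpos m).ne' (hbpos n).ne', Real.log_mul two_ne_zero (hbpos _).ne'] at this
    simp only [hu]
    linarith
  have hbdd : BddBelow (Set.range fun n => u n / n) := by
    refine ⟨-Real.log Δ, ?_⟩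
    rintro _ ⟨n, rfl⟩
    have hD : (1 : ℝ) ≤ Δ := by exact_mod_cast (show 1 ≤ Δ by omega)
    rcases Nat.eq_zero_or_pos n with rfl | hn
    · simpa using Real.log_nonneg hD
    · have hn' : (0 : ℝ) < n := by exact_mod_cast hn
      have h1 : b n ≤ Δ ^ n := max_le (Nat.one_le_pow _ _ (by omega))
        ((codeCount_le_pow (by omega) _).trans (Nat.pow_le_pow_right (by omega) (by omega)))
      have h2 : Real.log (b n) ≤ n * Real.log Δ := by
        rw [← Real.log_pow]
        exact Real.log_le_log (hbpos n) (by exact_mod_cast h1)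
      have h3 := Real.log_nonneg one_le_two
      simp only [hu]
      rw [le_div_iff₀ hn']
      linarith
  have hexp : ∀ n, (b n : ℝ) = 2 * Real.exp (-u n) := by
    intro n
    simp only [hu]
    rw [neg_sub, Real.exp_sub, Real.exp_log (hbpos n), Real.exp_log two_pos]
    ring
  set L := hsub.lim with hL
  refine ⟨L, 2 * Real.exp (-L), by positivity, fun n => ?_, fun δ hδ => ?_⟩
  · have h1 : (codeCount Δ n : ℝ) ≤ b (n + 1) := by
      exact_mod_cast le_max_right 1 (codeCount Δ n)
    have h2 := hsub.lim_le_div hbdd (Nat.succ_ne_zero n)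
    rw [le_div_iff₀ (by positivity)] at h2
    push_cast at h2
    refine h1.trans ?_
    rw [hexp, mul_assoc, ← Real.exp_add]
    gcongr
    linarith
  · refine ⟨2 * Real.exp (-L - δ), by positivity, ?_⟩
    have ht := (hsub.tendsto_lim hbdd).eventually (gt_mem_nhds (show L < L + δ by linarith))
    filter_upwards [(tendsto_add_atTop_nat 1).eventually ht, eventually_ge_atTop 1] with n hn hn1
    have h1 : (codeCount Δ n : ℝ) = b (n + 1) := by
      have := max_eq_right (one_le_codeCount hΔ hn1)
      simp only [hb, Nat.add_sub_cancel, this]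
    rw [div_lt_iff₀ (by positivity)] at hn
    push_cast at hn
    rw [h1, hexp, mul_assoc, mul_assoc, ← Real.exp_add, ← Real.exp_add]
    refine mul_le_mul_of_nonneg_left (Real.exp_le_exp.2 ?_) zero_le_two
    linarith

/-- At the radius of convergence `ρ < 1` the generating function of the bounded trees is finite,
and `ρ` governs the growth of their numbers. -/
theorem exists_radius {Δ : ℕ} (hΔ : 3 ≤ Δ) (i j : ℕ) : ∃ ρ : ℝ, 0 < ρ ∧ ρ < 1 ∧
    ∑' T, weight Δ i j (ENNReal.ofReal ρ) 1 T ≠ ⊤ ∧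
    ∀ δ > 0, ∃ c > 0, ∀ᶠ n : ℕ in atTop, c * Real.exp (-δ * n) ≤ codeCount Δ n * ρ ^ n := by
  obtain ⟨L, C, hC, hupper, hlower⟩ := exists_growth_rate hΔ
  set ρ := Real.exp L with hρ
  have hρpos : 0 < ρ := Real.exp_pos L
  have hpow : ∀ n : ℕ, Real.exp (L * n) = ρ ^ n := fun n => by
    rw [hρ, ← Real.exp_nat_mul, mul_comm]
  have hconv : ∀ x, 0 < x → x < ρ → ∑' T, weight Δ i j (ENNReal.ofReal x) 1 T ≠ ⊤ := by
    intro x hx hxρ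
    have hg := summable_geometric_of_lt_one (r := x / ρ) (by positivity) ((div_lt_one hρpos).2 hxρ)
    have hs : Summable fun n => (codeCount Δ n : ℝ) * x ^ n := by
      refine Summable.of_nonneg_of_le (fun n => by positivity) (fun n => ?_) (hg.mul_left C)
      calc (codeCount Δ n : ℝ) * x ^ n ≤ C * Real.exp (-L * n) * x ^ n := by gcongr; exact hupper n
        _ = C * (x / ρ) ^ n := by
          rw [neg_mul, Real.exp_neg, hpow, div_pow]; ring
    rw [tsum_weight_one]
    convert hs.tsum_ofReal_ne_top using 4 with n
    rw [ENNReal.ofReal_mul (by positivity), ENNReal.ofReal_natCast, ENNReal.ofReal_pow hx.le]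
  have hfin : ∑' T, weight Δ i j (ENNReal.ofReal ρ) 1 T ≠ ⊤ := by
    have hN : ∀ N, ∑ n ∈ Finset.range N, (codeCount Δ n : ℝ≥0∞) * ENNReal.ofReal ρ ^ n ≤
        ENNReal.ofReal (2 / ρ) := by
      intro N
      have hform : ∀ x, 0 < x → ∑ n ∈ Finset.range N, (codeCount Δ n : ℝ≥0∞) * ENNReal.ofReal x ^ n
          = ENNReal.ofReal (∑ n ∈ Finset.range N, codeCount Δ n * x ^ n) := by
        intro x hx
        rw [ENNReal.ofReal_sum_of_nonneg fun n _ => by positivity]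
        refine Finset.sum_congr rfl fun n _ => ?_
        rw [ENNReal.ofReal_mul (by positivity), ENNReal.ofReal_natCast, ENNReal.ofReal_pow hx.le]
      rw [hform ρ hρpos]
      refine ENNReal.ofReal_le_ofReal ?_
      rw [le_div_iff₀' hρpos]
      have hcont : Continuous fun x : ℝ => x * ∑ n ∈ Finset.range N, codeCount Δ n * x ^ n := by
        fun_prop
      refine le_of_tendsto (hcont.continuousWithinAt (s := Set.Iio ρ) (x := ρ)) ?_
      filter_upwards [Ioo_mem_nhdsLT hρpos] with x hx
      have h := mul_tsum_weight_le_two hΔ (hconv x hx.1 hx.2)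
      rw [tsum_weight_one] at h
      have h' := (mul_le_mul_right (ENNReal.sum_le_tsum (Finset.range N)) _).trans h
      rw [hform x hx.1, ← ENNReal.ofReal_mul hx.1.le] at h'
      exact (ENNReal.ofReal_le_ofReal_iff zero_le_two).1 (by simpa using h')
    rw [tsum_weight_one]
    refine ((ENNReal.tsum_eq_iSup_nat.trans_le (iSup_le hN)).trans_lt ENNReal.ofReal_lt_top).ne
  refine ⟨ρ, hρpos, ?_, hfin, fun δ hδ => by simpa only [hpow] using hlower δ hδ⟩
  by_contra! hρ1
  refine hfin (top_le_iff.1 ?_)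
  rw [tsum_weight_one]
  calc (⊤ : ℝ≥0∞) = ∑' _ : ℕ, 1 := (ENNReal.tsum_const_eq_top_of_ne_zero one_ne_zero).symm
    _ ≤ ∑' n, (codeCount Δ (n + 1) : ℝ≥0∞) * ENNReal.ofReal ρ ^ (n + 1) := by
      refine ENNReal.tsum_le_tsum fun n => ?_
      refine one_le_mul_of_one_le_of_one_le ?_ (one_le_pow₀ (by simpa using hρ1))
      exact_mod_cast one_le_codeCount hΔ (by omega)
    _ ≤ _ := ENNReal.tsum_comp_le_tsum_of_injective (add_left_injective 1)
      fun n => (codeCount Δ n : ℝ≥0∞) * ENNReal.ofReal ρ ^ n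

/-- Exponentially tilted sums of the powers of an exponentially small summable family. -/
theorem exists_hasDerivAt_tilt {a N ℓ : ℕ → ℝ} {γ K : ℝ} (hγ : 0 < γ) (ha : Summable a)
    (ha0 : ∀ T, 0 ≤ a T) (hN : ∀ T, 0 ≤ N T) (haN : ∀ T, a T ≤ Real.exp (-γ * N T))
    (hK : 0 ≤ K) (hℓ : ∀ T, |ℓ T| ≤ K * N T) : ∃ t₀ > 0, ∀ r : ℕ,
      Summable (fun T => a T ^ (r + 2) * ((r + 2) * ℓ T)) ∧
      (∀ t ∈ Set.Ioo (-t₀) t₀, Summable fun T => (a T * Real.exp (t * ℓ T)) ^ (r + 2)) ∧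
      HasDerivAt (fun t => ∑' T, (a T * Real.exp (t * ℓ T)) ^ (r + 2))
        (∑' T, a T ^ (r + 2) * ((r + 2) * ℓ T)) 0 := by
  have hsum0 : ∀ r : ℕ, Summable fun T => (a T * Real.exp (0 * ℓ T)) ^ (r + 2) := by
    intro r
    refine Summable.of_nonneg_of_le (fun T => by have := ha0 T; positivity) (fun T => ?_) ha
    rw [zero_mul, Real.exp_zero, mul_one]
    refine pow_le_of_le_one (ha0 T) ((haN T).trans (Real.exp_le_one_iff.2 ?_)) (by omega)
    nlinarith [mul_nonneg hγ.le (hN T)]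
  set t₀ := γ / (4 * (K + 1)) with ht₀
  have ht₀pos : 0 < t₀ := by positivity
  have hKt : t₀ * K ≤ γ / 4 := by
    rw [ht₀, div_mul_eq_mul_div, div_le_div_iff₀ (by positivity) (by positivity)]
    nlinarith
  have hbound : ∀ (r T : ℕ), ∀ t ∈ Set.Ioo (-t₀) t₀,
      ‖(a T * Real.exp (t * ℓ T)) ^ (r + 2) * ((r + 2) * ℓ T)‖ ≤ 4 * K / γ * a T := by
    intro r T t ht
    have hexp : t * ℓ T ≤ γ / 4 * N T := by
      calc t * ℓ T ≤ |t| * |ℓ T| := (le_abs_self _).trans (abs_mul _ _).le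
        _ ≤ t₀ * (K * N T) := by
          gcongr
          · exact (abs_lt.2 ht).le
          · exact hℓ T
        _ ≤ γ / 4 * N T := by
          rw [← mul_assoc]
          exact mul_le_mul_of_nonneg_right hKt (hN T)
    set x : ℝ := (r + 1) * N T with hx
    have hx0 : 0 ≤ x := mul_nonneg (by positivity) (hN T)
    have hpow : (a T * Real.exp (t * ℓ T)) ^ (r + 2) ≤ a T * Real.exp (-(γ / 2 * x)) := by
      calc (a T * Real.exp (t * ℓ T)) ^ (r + 2)
          = a T * a T ^ (r + 1) * Real.exp (t * ℓ T) ^ (r + 2) := by ring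
        _ ≤ a T * Real.exp (-γ * N T) ^ (r + 1) * Real.exp (γ / 4 * N T) ^ (r + 2) := by
          have := ha0 T
          gcongr
          exact haN T
        _ = a T * Real.exp ((r + 1) * (-γ * N T) + (r + 2) * (γ / 4 * N T)) := by
          rw [← Real.exp_nat_mul, ← Real.exp_nat_mul, mul_assoc, ← Real.exp_add]
          push_cast
          rfl
        _ ≤ _ := by
          refine mul_le_mul_of_nonneg_left (Real.exp_le_exp.2 ?_) (ha0 T)
          have : 0 ≤ γ * N T * r := by have := hN T; positivity
          rw [hx]
          nlinarith
    have hℓx : |(r + 2) * ℓ T| ≤ 2 * K * x := by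
      rw [abs_mul, abs_of_nonneg (by positivity)]
      calc ((r : ℝ) + 2) * |ℓ T| ≤ (2 * (r + 1)) * (K * N T) := by
            gcongr
            · linarith [(Nat.cast_nonneg r : (0 : ℝ) ≤ r)]
            · exact hℓ T
        _ = 2 * K * x := by rw [hx]; ring
    have hxe : x * Real.exp (-(γ / 2 * x)) ≤ 2 / γ := by
      rw [Real.exp_neg, ← div_eq_mul_inv, div_le_div_iff₀ (Real.exp_pos _) hγ]
      have := Real.add_one_le_exp (γ / 2 * x)
      linarith
    rw [norm_mul, Real.norm_eq_abs, Real.norm_eq_abs,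
      abs_of_nonneg (by have := ha0 T; positivity)]
    calc _ ≤ a T * Real.exp (-(γ / 2 * x)) * (2 * K * x) := by
          have := ha0 T
          gcongr
      _ = 2 * K * a T * (x * Real.exp (-(γ / 2 * x))) := by ring
      _ ≤ 2 * K * a T * (2 / γ) := by
          have := ha0 T
          gcongr
      _ = _ := by ring
  have h0 : (0 : ℝ) ∈ Set.Ioo (-t₀) t₀ := by simpa using ht₀pos
  set g : ℕ → ℕ → ℝ → ℝ := fun r T t => (a T * Real.exp (t * ℓ T)) ^ (r + 2) with hg
  set g' : ℕ → ℕ → ℝ → ℝ := fun r T t =>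
    (a T * Real.exp (t * ℓ T)) ^ (r + 2) * ((r + 2) * ℓ T) with hg'
  have hderiv : ∀ (r T : ℕ), ∀ t ∈ Set.Ioo (-t₀) t₀, HasDerivAt (g r T) (g' r T t) t := by
    intro r T t _
    have h := ((((hasDerivAt_id t).mul_const (ℓ T)).exp).const_mul (a T)).fun_pow (r + 2)
    refine h.congr_deriv ?_
    simp only [hg', id, one_mul]
    push_cast
    ring
  have hu : Summable fun T => 4 * K / γ * a T := ha.mul_left _
  refine ⟨t₀, ht₀pos, fun r => ⟨?_, fun t ht => ?_, ?_⟩⟩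
  · refine Summable.of_norm_bounded hu fun T => ?_
    simpa using hbound r T 0 h0
  · exact summable_of_summable_hasDerivAt_of_isPreconnected (g := g r) (g' := g' r) hu isOpen_Ioo
      isPreconnected_Ioo (hderiv r) (hbound r) h0 (hsum0 r) ht
  · have := hasDerivAt_tsum_of_isPreconnected (g := g r) (g' := g' r) hu isOpen_Ioo
      isPreconnected_Ioo (hderiv r) (hbound r) h0 (hsum0 r) h0
    simpa [hg'] using this

/-- The power sums of the perturbed system. -/
noncomputable def tiltedPower (Δ : ℕ) (e : ℕ → ℝ) (p : ℕ → ℝ) (D : ℕ → ℕ → ℝ) (b : ℝ) (r : ℕ) : ℝ :=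
  if r ≤ 1 then ∑ l ∈ Finset.range Δ, Real.exp (b * e l) * p l
  else ∑ l ∈ Finset.range Δ, Real.exp (b * e l) ^ r * D r l

/-- Supersolutions exist in every direction in which the linearised system decreases. -/
theorem exists_supersolution {Δ : ℕ} (hΔ : 0 < Δ) {ρ : ℝ} (hρ : 0 < ρ) (e : ℕ → ℕ → ℝ) {P : ℕ → ℝ}
    (hP : ∀ k < Δ, 0 < P k) {D₀ A₀ : ℕ → ℕ → ℝ} (B₀ : ℕ → ℕ → ℝ) (hD₀ : ∀ r l, 0 ≤ D₀ r l)
    (hA₀ : ∀ r l, 0 ≤ A₀ r l)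
    (hPeq : ∀ k < Δ, P k = ρ * newton (tiltedPower Δ (e k) P D₀ 0) k) :
    ∃ μ : ℝ, ∀ ε > 0, ∀ (β : ℝ) (D : ℝ → ℕ → ℕ → ℝ),
      (∀ r l, D 0 (r + 2) l = D₀ (r + 2) l) →
      (∀ r l, HasDerivAt (fun t => D t (r + 2) l)
        (-(β * μ + ε) * A₀ (r + 2) l + β * B₀ (r + 2) l) 0) →
      ∀ᶠ t in 𝓝[>] (0 : ℝ), ∃ p : ℕ → ℝ, (∀ l < Δ, 0 ≤ p l) ∧
        ∀ k < Δ, ρ * Real.exp (-(β * μ + ε) * t) *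
          newton (tiltedPower Δ (e k) p (D t) (β * t)) k ≤ p k := by
  set dA : ℕ → ℝ := fun r => if r = 1 then 0 else ∑ l ∈ Finset.range Δ, A₀ r l with hdA
  set dB : ℕ → ℕ → ℝ := fun k r => if r = 1 then ∑ l ∈ Finset.range Δ, e k l * P l else
    ∑ l ∈ Finset.range Δ, (r * e k l * D₀ r l + B₀ r l) with hdB
  set S : ℕ → ℕ → ℝ := fun k => tiltedPower Δ (e k) P D₀ 0 with hS
  set A : ℕ → ℝ := fun k => P k + ρ * newtonDeriv (S k) dA k with hA
  set B : ℕ → ℝ := fun k => ρ * newtonDeriv (S k) (dB k) k with hB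
  have hApos : 0 < ∑ k ∈ Finset.range Δ, A k := by
    refine Finset.sum_pos (fun k hk => ?_) (by simpa using hΔ.ne')
    refine add_pos_of_pos_of_nonneg (hP k (Finset.mem_range.1 hk))
      (mul_nonneg hρ.le (newtonDeriv_nonneg (fun r => ?_) (fun r => ?_) k))
    · simp only [hS, tiltedPower]
      split_ifs
      · refine Finset.sum_nonneg fun l hl => ?_
        have := hP l (Finset.mem_range.1 hl)
        positivity
      · refine Finset.sum_nonneg fun l hl => ?_
        have := hD₀ (r + 1) l
        positivity
    · simp only [hdA]
      split_ifs
      · exact le_rfl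
      · exact Finset.sum_nonneg fun l _ => hA₀ _ _
  set At := ∑ k ∈ Finset.range Δ, A k with hAt
  set Bt := ∑ k ∈ Finset.range Δ, B k with hBt
  refine ⟨Bt / At, fun ε hε β D hD hD' => ?_⟩
  set α := -(β * (Bt / At) + ε) with hα
  set η := ε * At / Δ with hη
  have hΔ' : (0 : ℝ) < Δ := by exact_mod_cast hΔ
  have hηpos : 0 < η := by positivity
  set v : ℕ → ℝ := fun k => α * A k + β * B k + η with hv
  have hvsum : ∑ k ∈ Finset.range Δ, v k = 0 := by
    simp only [hv, Finset.sum_add_distrib, ← Finset.mul_sum, ← hAt, ← hBt, Finset.sum_const,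
      Finset.card_range, nsmul_eq_mul, hη, hα]
    field_simp
    ring
  set p : ℝ → ℕ → ℝ := fun t l => P l + t * v l with hp
  have hp' : ∀ l, HasDerivAt (fun t => p t l) (v l) 0 := fun l => by
    have := ((hasDerivAt_id (0 : ℝ)).mul_const (v l)).const_add (P l)
    exact this.congr_deriv (one_mul _)
  have hE : ∀ k l, HasDerivAt (fun t => Real.exp (β * t * e k l)) (β * e k l) 0 := fun k l => by
    simpa using (((hasDerivAt_id (0 : ℝ)).const_mul β).mul_const (e k l)).exp
  have hs : ∀ k r, HasDerivAt (fun t => tiltedPower Δ (e k) (p t) (D t) (β * t) (r + 1))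
      (α * dA (r + 1) + β * dB k (r + 1)) 0 := by
    intro k r
    cases r with
    | zero =>
      simp only [tiltedPower, hdA, hdB, zero_add, if_true]
      have := HasDerivAt.fun_sum (u := Finset.range Δ) fun l _ => (hE k l).mul (hp' l)
      refine this.congr_deriv ?_
      simp [hp, Finset.sum_add_distrib, hvsum, Finset.mul_sum, mul_assoc]
    | succ r =>
      simp only [tiltedPower, hdA, hdB, Nat.add_eq_right, Nat.succ_ne_zero, if_false]
      have := HasDerivAt.fun_sum (u := Finset.range Δ) fun l _ =>
        ((hE k l).fun_pow (r + 2)).mul (hD' r l)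
      refine this.congr_deriv ?_
      simp only [Finset.mul_sum, ← Finset.sum_add_distrib]
      refine Finset.sum_congr rfl fun l _ => ?_
      simp [hD]
      ring
  have hs0 : ∀ k, tiltedPower Δ (e k) (p 0) (D 0) (β * 0) = S k := by
    intro k
    ext r
    match r with
    | 0 => simp [tiltedPower, hS, hp]
    | 1 => simp [tiltedPower, hS, hp]
    | r + 2 => simp [tiltedPower, hS, hD]
  have hp0 : ∀ k < Δ, ∀ᶠ t in 𝓝[>] (0 : ℝ), 0 ≤ p t k := fun k hk => by
    have h : ∀ᶠ t in 𝓝 (0 : ℝ), 0 < p t k :=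
      (hp' k).continuousAt.eventually (lt_mem_nhds (by simpa [hp] using hP k hk))
    exact (h.filter_mono nhdsWithin_le_nhds).mono fun _ => le_of_lt
  have hdiff : ∀ k < Δ, ∀ᶠ t in 𝓝[>] (0 : ℝ), ρ * Real.exp (α * t) *
      newton (tiltedPower Δ (e k) (p t) (D t) (β * t)) k ≤ p t k := by
    intro k hk
    have hnewton := hasDerivAt_newton (s := fun t => tiltedPower Δ (e k) (p t) (D t) (β * t))
      (d := fun r => α * dA r + β * dB k r) (hs k) k
    have hexp : HasDerivAt (fun t => ρ * Real.exp (α * t)) (ρ * α) 0 := by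
      simpa using (((hasDerivAt_id (0 : ℝ)).const_mul α).exp).const_mul ρ
    have hd := (hp' k).sub (hexp.mul hnewton)
    have hη0 : v k - (ρ * α * newton (S k) k + ρ * newtonDeriv (S k)
        (fun r => α * dA r + β * dB k r) k) = η := by
      rw [newtonDeriv_linear]
      have := hPeq k hk
      simp only [hv, hA, hB]
      rw [mul_assoc ρ α, mul_left_comm ρ α, ← this]
      ring
    rw [hs0] at hd
    simp only [mul_zero, Real.exp_zero, mul_one] at hd
    have hη1 := hd.congr_deriv hη0
    have hzero : p 0 k - ρ * newton (S k) k = 0 := by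
      rw [← hPeq k hk]; simp [hp]
    have hslope := (hasDerivAt_iff_tendsto_slope.1 hη1).eventually (lt_mem_nhds hηpos)
    have hslope := hslope.filter_mono (nhdsWithin_mono (0 : ℝ) (t := {0}ᶜ) (s := Set.Ioi 0)
      fun t ht => ne_of_gt ht)
    filter_upwards [hslope, self_mem_nhdsWithin] with t ht ht0
    rw [slope_def_field] at ht
    have ht0 : (0 : ℝ) < t := ht0
    have := (div_pos_iff_of_pos_right (by simpa using ht0)).1 ht
    simp only [Pi.sub_apply, Pi.mul_apply, hs0] at this
    rw [mul_zero, Real.exp_zero, mul_one, hzero] at this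
    linarith
  have hp0 := (Filter.eventually_all_finset (Finset.range Δ)).2
    fun k hk => hp0 k (Finset.mem_range.1 hk)
  have hdiff := (Filter.eventually_all_finset (Finset.range Δ)).2
    fun k hk => hdiff k (Finset.mem_range.1 hk)
  filter_upwards [hp0, hdiff] with t h1 h2
  exact ⟨p t, fun k hk => h1 k (Finset.mem_range.2 hk), fun k hk => h2 k (Finset.mem_range.2 hk)⟩

theorem newton_congr {s s' : ℕ → ℝ} (h : ∀ r, s (r + 1) = s' (r + 1)) (k : ℕ) :
    newton s k = newton s' k := by
  induction k using Nat.strong_induction_on with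
  | _ k ih =>
    cases k with
    | zero => simp [newton_zero]
    | succ k =>
      rw [newton_succ, newton_succ]
      congr 1
      refine Finset.sum_congr rfl fun r _ => ?_
      rw [h, ih (k - r) (by omega)]

/-- The weight `ρ ^ size` on the bounded coded trees with `l` branches at the root. -/
noncomputable def levelWeight (Δ : ℕ) (ρ : ℝ) (l T : ℕ) : ℝ :=
  open Classical in if rootDeg T = l ∧ Bounded Δ T then ρ ^ size T else 0

theorem levelWeight_nonneg {Δ : ℕ} {ρ : ℝ} (hρ : 0 ≤ ρ) (l T : ℕ) : 0 ≤ levelWeight Δ ρ l T := by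
  unfold levelWeight
  split_ifs <;> positivity

theorem weight_tilt {Δ i j : ℕ} {ρ : ℝ} (hρ : 0 ≤ ρ) (α β t : ℝ) (l T : ℕ) {r : ℕ} (hr : r ≠ 0) :
    (if rootDeg T = l then weight Δ i j (ENNReal.ofReal (ρ * Real.exp (α * t)))
      (ENNReal.ofReal (Real.exp (β * t))) T ^ r else 0) =
    ENNReal.ofReal ((levelWeight Δ ρ l T *
      Real.exp (t * (α * size T + β * edges i j T))) ^ r) := by
  rw [ENNReal.ofReal_pow (mul_nonneg (levelWeight_nonneg hρ l T) (Real.exp_nonneg _)),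
    levelWeight, weight]
  by_cases h : rootDeg T = l <;> by_cases h' : Bounded Δ T
  · rw [if_pos h, if_pos h', if_pos ⟨h, h'⟩, ← ENNReal.ofReal_pow (by positivity),
      ← ENNReal.ofReal_pow (by positivity), ← ENNReal.ofReal_mul (by positivity), mul_pow,
      ← Real.exp_nat_mul, ← Real.exp_nat_mul, mul_assoc, ← Real.exp_add]
    congr 4
    ring
  all_goals simp [h, h', hr]

theorem levelSum_tilt {Δ i j : ℕ} {ρ : ℝ} (hρ : 0 ≤ ρ) (α β t : ℝ) (l : ℕ) {r : ℕ} (hr : r ≠ 0)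
    (hs : Summable fun T => (levelWeight Δ ρ l T *
      Real.exp (t * (α * size T + β * edges i j T))) ^ r) :
    levelSum Δ i j (ENNReal.ofReal (ρ * Real.exp (α * t))) (ENNReal.ofReal (Real.exp (β * t))) r l
      = ENNReal.ofReal (∑' T, (levelWeight Δ ρ l T *
          Real.exp (t * (α * size T + β * edges i j T))) ^ r) := by
  rw [levelSum, ENNReal.ofReal_tsum_of_nonneg (fun T => pow_nonneg
    (mul_nonneg (levelWeight_nonneg hρ l T) (Real.exp_nonneg _)) r) hs]
  exact tsum_congr fun T => weight_tilt hρ α β t l T hr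

theorem levelSum_one {Δ i j : ℕ} {ρ : ℝ} (hρ : 0 ≤ ρ) (l : ℕ) {r : ℕ} (hr : r ≠ 0)
    (hs : Summable fun T => levelWeight Δ ρ l T ^ r) :
    levelSum Δ i j (ENNReal.ofReal ρ) 1 r l = ENNReal.ofReal (∑' T, levelWeight Δ ρ l T ^ r) := by
  have := levelSum_tilt (i := i) (j := j) hρ 0 0 0 l hr (by simpa using hs)
  simpa using this

/-- The exponent of the edge factor. -/
def edgeIndicator (i j k l : ℕ) : ℝ := if PairMatch i j (k + 1) (l + 1) then 1 else 0

theorem edgeFactor_exp (i j k l : ℕ) (b : ℝ) : edgeFactor i j (ENNReal.ofReal (Real.exp b)) k l =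
    ENNReal.ofReal (Real.exp (b * edgeIndicator i j k l)) := by
  unfold edgeFactor edgeIndicator
  split_ifs <;> simp

section Radius

variable {Δ i j : ℕ} {ρ : ℝ}

theorem summable_levelWeight (hρ : 0 ≤ ρ)
    (hfin : ∑' T, weight Δ i j (ENNReal.ofReal ρ) 1 T ≠ ⊤) (l : ℕ) :
    Summable (levelWeight Δ ρ l) := by
  have h : ∀ T, ENNReal.ofReal (levelWeight Δ ρ l T) ≤ weight Δ i j (ENNReal.ofReal ρ) 1 T := by
    intro T
    have := weight_tilt (Δ := Δ) (i := i) (j := j) hρ 0 0 0 l T one_ne_zero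
    simp only [zero_mul, Real.exp_zero, mul_one, pow_one, ENNReal.ofReal_one] at this
    rw [← this]
    split_ifs <;> simp
  have := ENNReal.summable_toReal (ne_top_of_le_ne_top hfin (ENNReal.tsum_le_tsum h))
  refine this.congr fun T => ?_
  rw [ENNReal.toReal_ofReal (levelWeight_nonneg hρ l T)]

theorem levelWeight_le_one (hρ : 0 ≤ ρ) (hρ1 : ρ ≤ 1) (l T : ℕ) : levelWeight Δ ρ l T ≤ 1 := by
  unfold levelWeight
  split_ifs
  · exact pow_le_one₀ hρ hρ1
  · exact zero_le_one

theorem levelWeight_le_exp (hρ : 0 < ρ) (l T : ℕ) :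
    levelWeight Δ ρ l T ≤ Real.exp (-(-Real.log ρ) * size T) := by
  rw [neg_neg, mul_comm, Real.exp_nat_mul, Real.exp_log hρ]
  unfold levelWeight
  split_ifs
  · exact le_rfl
  · positivity

theorem tsum_levelWeight_pos (hΔ : 2 ≤ Δ) (hρ : 0 < ρ) {l : ℕ} (hl : l < Δ)
    (hs : Summable (levelWeight Δ ρ l)) : 0 < ∑' T, levelWeight Δ ρ l T := by
  refine hs.tsum_pos (levelWeight_nonneg hρ.le l)
    (branches.symm (Multiset.replicate l (branches.symm 0))) ?_
  rw [levelWeight, if_pos]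
  · positivity
  · refine ⟨by simp [rootDeg_symm], bounded_symm.2 ⟨by simpa using hl, fun c hc => ?_⟩⟩
    rw [Multiset.eq_of_mem_replicate hc]
    exact bounded_symm.2 ⟨by simp; omega, by simp⟩

theorem tsum_levelWeight_eq (hρ : 0 ≤ ρ)
    (hs : ∀ r l, Summable fun T => levelWeight Δ ρ l T ^ (r + 1))
    {k : ℕ} (hk : k < Δ) : ∑' T, levelWeight Δ ρ k T =
      ρ * newton (tiltedPower Δ (edgeIndicator i j k) (fun l => ∑' T, levelWeight Δ ρ l T)
        (fun r l => ∑' T, levelWeight Δ ρ l T ^ r) 0) k := by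
  have hnn : ∀ r l, 0 ≤ ∑' T, levelWeight Δ ρ l T ^ r := fun r l =>
    tsum_nonneg fun T => pow_nonneg (levelWeight_nonneg hρ l T) r
  have hpsum : ∀ r, psum (fun c => weight Δ i j (ENNReal.ofReal ρ) 1 c *
      edgeFactor i j 1 k (rootDeg c)) (r + 1) =
      ENNReal.ofReal (∑ l ∈ Finset.range Δ, ∑' T, levelWeight Δ ρ l T ^ (r + 1)) := by
    intro r
    rw [psum_weight _ _ _ (Nat.succ_ne_zero r), ENNReal.ofReal_sum_of_nonneg fun l _ => hnn _ l]
    refine Finset.sum_congr rfl fun l _ => ?_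
    rw [edgeFactor_one, one_pow, one_mul, levelSum_one hρ l (Nat.succ_ne_zero r) (hs r l)]
  have h := tsum_weight_rootDeg (i := i) (j := j) (ENNReal.ofReal ρ) 1 hk
  rw [hsum_eq_newton fun r => by rw [hpsum]; exact ENNReal.ofReal_ne_top,
    ← ENNReal.ofReal_mul hρ] at h
  have h1 := levelSum_one (Δ := Δ) (i := i) (j := j) hρ k one_ne_zero (hs 0 k)
  simp only [levelSum, pow_one] at h1
  rw [h1, ENNReal.ofReal_eq_ofReal_iff (by simpa using hnn 1 k)
    (mul_nonneg hρ (newton_nonneg (fun r => ENNReal.toReal_nonneg) k))] at h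
  rw [h]
  congr 1
  refine newton_congr (fun r => ?_) k
  rw [hpsum, ENNReal.toReal_ofReal (Finset.sum_nonneg fun l _ => hnn _ l)]
  cases r with
  | zero => simp [tiltedPower]
  | succ r => simp [tiltedPower]

/-- Exponential tilting in the directions that decrease the linearised system keeps the generating
function finite. -/
theorem exists_tilt (hΔ : 2 ≤ Δ) (hρ : 0 < ρ) (hρ1 : ρ < 1)
    (hfin : ∑' T, weight Δ i j (ENNReal.ofReal ρ) 1 T ≠ ⊤) :
    ∃ μ : ℝ, ∀ ε > 0, ∀ β : ℝ, ∃ t > 0,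
      ∑' T, weight Δ i j (ENNReal.ofReal (ρ * Real.exp (-(β * μ + ε) * t)))
        (ENNReal.ofReal (Real.exp (β * t))) T ≠ ⊤ := by
  have hnn := levelWeight_nonneg (Δ := Δ) hρ.le
  have hs := summable_levelWeight hρ.le hfin
  have hspow : ∀ r l, Summable fun T => levelWeight Δ ρ l T ^ (r + 1) := fun r l =>
    Summable.of_nonneg_of_le (fun T => pow_nonneg (hnn l T) _)
      (fun T => pow_le_of_le_one (hnn l T) (levelWeight_le_one hρ.le hρ1.le l T)
        (Nat.succ_ne_zero r))
      (hs l)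
  have hγ : 0 < -Real.log ρ := neg_pos.2 (Real.log_neg hρ hρ1)
  have htilt := fun (l : ℕ) (ℓ : ℕ → ℝ) (K : ℝ) => exists_hasDerivAt_tilt (ℓ := ℓ) (K := K)
    (N := fun T => (size T : ℝ)) hγ (hs l) (hnn l) (fun T => Nat.cast_nonneg _)
    (levelWeight_le_exp hρ l)
  have hedges : ∀ T, (edges i j T : ℝ) ≤ size T := fun T => by
    exact_mod_cast (edges_lt_size i j T).le
  set D₀ : ℕ → ℕ → ℝ := fun r l => ∑' T, levelWeight Δ ρ l T ^ r with hD₀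
  set A₀ : ℕ → ℕ → ℝ := fun r l => ∑' T, levelWeight Δ ρ l T ^ r * (r * size T) with hA₀
  set B₀ : ℕ → ℕ → ℝ := fun r l => ∑' T, levelWeight Δ ρ l T ^ r * (r * edges i j T) with hB₀
  obtain ⟨μ, hμ⟩ := exists_supersolution (Δ := Δ) (by omega) hρ (edgeIndicator i j)
    (P := fun l => ∑' T, levelWeight Δ ρ l T) (D₀ := D₀) (A₀ := A₀)
    (fun k hk => tsum_levelWeight_pos hΔ hρ hk (hs k)) B₀
    (fun r l => tsum_nonneg fun T => pow_nonneg (hnn l T) r)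
    (fun r l => tsum_nonneg fun T => mul_nonneg (pow_nonneg (hnn l T) r) (by positivity))
    (fun k hk => tsum_levelWeight_eq hρ.le hspow hk)
  refine ⟨μ, fun ε hε β => ?_⟩
  set α := -(β * μ + ε) with hα
  choose t₀ ht₀ htl using fun l => htilt l (fun T => α * size T + β * edges i j T) (|α| + |β|)
    (by positivity) fun T => by
      rw [add_mul]
      refine (abs_add_le _ _).trans (add_le_add ?_ ?_)
      · rw [abs_mul, Nat.abs_cast]
      · rw [abs_mul, Nat.abs_cast]
        exact mul_le_mul_of_nonneg_left (hedges T) (abs_nonneg β)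
  set D : ℝ → ℕ → ℕ → ℝ := fun t r l => ∑' T, (levelWeight Δ ρ l T *
    Real.exp (t * (α * size T + β * edges i j T))) ^ r with hD
  have hsupersol := hμ ε hε β D (fun r l => by simp [hD, hD₀]) fun r l => by
    refine (htl l r).2.2.congr_deriv ?_
    obtain ⟨_, _, h1⟩ := htilt l (fun T => size T) 1 zero_le_one (by simp)
    obtain ⟨_, _, h2⟩ := htilt l (fun T => edges i j T) 1 zero_le_one (by simpa using hedges)
    simp only [hA₀, hB₀, ← tsum_mul_left]
    push_cast
    rw [← Summable.tsum_add ((h1 r).1.mul_left α) ((h2 r).1.mul_left β)]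
    exact tsum_congr fun T => by ring
  have hsmall : ∀ᶠ t in 𝓝[>] (0 : ℝ), ∀ l ∈ Finset.range Δ, t < t₀ l :=
    (Filter.eventually_all_finset _).2 fun l _ =>
      (gt_mem_nhds (ht₀ l)).filter_mono nhdsWithin_le_nhds
  obtain ⟨t, ⟨⟨p, hp, hpG⟩, htsmall⟩, htpos⟩ :=
    ((hsupersol.and hsmall).and self_mem_nhdsWithin).exists
  have htpos : 0 < t := htpos
  have hDnn : ∀ r l, 0 ≤ D t r l := fun r l => tsum_nonneg fun T =>
    pow_nonneg (mul_nonneg (hnn l T) (Real.exp_nonneg _)) r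
  refine ⟨t, htpos, ?_⟩
  have hlevel := levelSum_one_le (Δ := Δ) (i := i) (j := j)
    (x := ENNReal.ofReal (ρ * Real.exp (α * t))) (y := ENNReal.ofReal (Real.exp (β * t)))
    (s := fun k => tiltedPower Δ (edgeIndicator i j k) p (D t) (β * t)) (p := p)
    (fun k r => by
      unfold tiltedPower
      split_ifs
      · exact Finset.sum_nonneg fun l hl =>
          mul_nonneg (Real.exp_nonneg _) (hp l (Finset.mem_range.1 hl))
      · exact Finset.sum_nonneg fun l hl =>
          mul_nonneg (pow_nonneg (Real.exp_nonneg _) r) (hDnn r l))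
    (fun k hk => by
      rw [tiltedPower, if_pos le_rfl, ENNReal.ofReal_sum_of_nonneg fun l hl =>
        mul_nonneg (Real.exp_nonneg _) (hp l (Finset.mem_range.1 hl))]
      refine Finset.sum_le_sum fun l hl => ?_
      rw [edgeFactor_exp, ENNReal.ofReal_mul (Real.exp_nonneg _)])
    (fun k hk r => by
      rw [tiltedPower, if_neg (by omega), ENNReal.ofReal_sum_of_nonneg fun l hl =>
        mul_nonneg (pow_nonneg (Real.exp_nonneg _) _) (hDnn _ l)]
      refine Finset.sum_le_sum fun l hl => ?_
      rw [edgeFactor_exp, ENNReal.ofReal_mul (pow_nonneg (Real.exp_nonneg _) _),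
        ENNReal.ofReal_pow (Real.exp_nonneg _), levelSum_tilt hρ.le α β t l (by omega)
          ((htl l r).2.1 t ⟨by linarith [ht₀ l], htsmall l hl⟩)])
    (fun k hk => by
      rw [← ENNReal.ofReal_mul (by positivity)]
      exact ENNReal.ofReal_le_ofReal (hpG k hk))
  rw [tsum_eq_sum_rootDeg (Δ := Δ) fun T hT => weight_eq_zero hT]
  refine ENNReal.sum_ne_top.2 fun k hk => ?_
  have := hlevel k (Finset.mem_range.1 hk)
  simp only [levelSum, pow_one] at this
  exact (this.trans_lt ENNReal.ofReal_lt_top).ne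

end Radius

theorem prob_nonneg (Δ n : ℕ) (P : TClass Δ n → Prop) : 0 ≤ prob Δ n P := by
  unfold prob; positivity

theorem prob_le_one (Δ n : ℕ) (P : TClass Δ n → Prop) : prob Δ n P ≤ 1 := by
  refine div_le_one_of_le₀ ?_ (Nat.cast_nonneg _)
  exact_mod_cast Finite.card_subtype_le P

theorem one_le_prob_add {Δ n : ℕ} (h0 : 0 < Nat.card (TClass Δ n)) {P Q R : TClass Δ n → Prop}
    (h : ∀ q, P q ∨ Q q ∨ R q) : 1 ≤ prob Δ n P + prob Δ n Q + prob Δ n R := by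
  classical
  have := Fintype.ofFinite (TClass Δ n)
  have h0' : (0 : ℝ) < Nat.card (TClass Δ n) := by exact_mod_cast h0
  rw [prob, prob, prob, ← add_div, ← add_div, le_div_iff₀ h0', one_mul]
  have key : Nat.card (TClass Δ n) ≤ Nat.card {q // P q} + Nat.card {q // Q q} +
      Nat.card {q // R q} := by
    simp only [Nat.card_eq_fintype_card, Fintype.card_subtype]
    rw [← Finset.card_univ]
    refine (Finset.card_le_card (t := Finset.univ.filter P ∪ Finset.univ.filter Q ∪
      Finset.univ.filter R) fun q _ => ?_).trans
      ((Finset.card_union_le _ _).trans (Nat.add_le_add_right (Finset.card_union_le _ _) _))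
    simpa [or_assoc] using h q
  exact_mod_cast key

/-- The number of classes with a large tilted edge count is exponentially small. -/
theorem exists_card_tail_le {Δ i j : ℕ} (hΔ : 3 ≤ Δ) {ρ μ ε β t : ℝ} (hρ : 0 < ρ) (ht : 0 < t)
    (hβ : |β| ≤ 1)
    (hfin : ∑' T, weight Δ i j (ENNReal.ofReal (ρ * Real.exp (-(β * μ + ε / 2) * t)))
        (ENNReal.ofReal (Real.exp (β * t))) T ≠ ⊤) :
    ∃ C : ℝ, 0 ≤ C ∧ ∀ n ≥ 2,
      Nat.card {q : TClass Δ n // (β * μ + ε) * n < β * Yedge Δ n i j q} *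
        (ρ ^ n * Real.exp (t * ε / 2 * n)) ≤ C := by
  refine ⟨(∑' T, weight Δ i j (ENNReal.ofReal (ρ * Real.exp (-(β * μ + ε / 2) * t)))
        (ENNReal.ofReal (Real.exp (β * t))) T).toReal * Real.exp t, by positivity, fun n hn => ?_⟩
  obtain ⟨τ, hτ, hτ'⟩ := exists_code_of_class hΔ hn i j
  set Q := {q : TClass Δ n // (β * μ + ε) * n < β * Yedge Δ n i j q} with hQ
  have hterm : ∀ q : Q, ENNReal.ofReal (ρ ^ n * Real.exp (t * ε / 2 * n - t)) ≤
      weight Δ i j (ENNReal.ofReal (ρ * Real.exp (-(β * μ + ε / 2) * t)))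
        (ENNReal.ofReal (Real.exp (β * t))) (τ q) := by
    rintro ⟨q, hq⟩
    obtain ⟨hb, hsz, h1, h2⟩ := hτ' q
    rw [weight, if_pos hb, hsz, ← ENNReal.ofReal_pow (by positivity),
      ← ENNReal.ofReal_pow (by positivity), ← ENNReal.ofReal_mul (by positivity)]
    refine ENNReal.ofReal_le_ofReal ?_
    rw [mul_pow, ← Real.exp_nat_mul, ← Real.exp_nat_mul, mul_assoc, ← Real.exp_add]
    refine mul_le_mul_of_nonneg_left (Real.exp_le_exp.2 ?_) (by positivity)
    have h3 : β * Yedge Δ n i j q - 1 ≤ β * edges i j (τ q) := by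
      have h1' : (Yedge Δ n i j q : ℝ) ≤ edges i j (τ q) + 1 := by exact_mod_cast h1
      have h2' : (edges i j (τ q) : ℝ) ≤ Yedge Δ n i j q + 1 := by exact_mod_cast h2
      have h3 : |(Yedge Δ n i j q : ℝ) - edges i j (τ q)| ≤ 1 := abs_sub_le_iff.2
        ⟨by linarith, by linarith⟩
      have h4 : |β * (Yedge Δ n i j q - edges i j (τ q))| ≤ 1 := by
        rw [abs_mul]
        exact mul_le_one₀ hβ (abs_nonneg _) h3
      have := le_of_abs_le h4
      linarith
    have h4 : ε / 2 * n - 1 ≤ n * -(β * μ + ε / 2) + edges i j (τ q) * β := by linarith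
    have := mul_le_mul_of_nonneg_left h4 ht.le
    linarith
  have hsum := (ENNReal.tsum_le_tsum hterm).trans
    (ENNReal.tsum_comp_le_tsum_of_injective (hτ.comp Subtype.val_injective) _)
  rw [ENNReal.tsum_const, ENat.card_eq_coe_natCard] at hsum
  have hreal := ENNReal.toReal_mono hfin hsum
  rw [ENNReal.toReal_mul, ENNReal.toReal_ofReal (by positivity)] at hreal
  have hcard : ((Nat.card Q : ℕ∞) : ℝ≥0∞).toReal = Nat.card Q := by simp
  rw [hcard, Real.exp_sub] at hreal
  refine le_of_eq_of_le ?_ (mul_le_mul_of_nonneg_right hreal (Real.exp_nonneg t))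
  field_simp

theorem tendsto_prob_tail {Δ i j : ℕ} (hΔ : 3 ≤ Δ) {ρ μ ε β t : ℝ} (hρ : 0 < ρ) (ht : 0 < t)
    (hε : 0 < ε) (hβ : |β| ≤ 1)
    (hgrowth : ∀ δ > 0, ∃ c > 0, ∀ᶠ n : ℕ in atTop,
      c * Real.exp (-δ * n) ≤ codeCount Δ n * ρ ^ n)
    (hfin : ∑' T, weight Δ i j (ENNReal.ofReal (ρ * Real.exp (-(β * μ + ε / 2) * t)))
        (ENNReal.ofReal (Real.exp (β * t))) T ≠ ⊤) :
    Tendsto (fun n : ℕ => prob Δ n fun q => (β * μ + ε) * n < β * Yedge Δ n i j q)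
      atTop (𝓝 0) := by
  obtain ⟨C, hC, hcard⟩ := exists_card_tail_le hΔ hρ ht hβ hfin
  obtain ⟨c, hc, hlower⟩ := hgrowth (t * ε / 4) (by positivity)
  have hlim : Tendsto (fun n : ℕ => C / c * (n * Real.exp (-(t * ε / 4)) ^ n)) atTop (𝓝 0) := by
    have := (tendsto_self_mul_const_pow_of_lt_one (Real.exp_nonneg (-(t * ε / 4)))
      (Real.exp_lt_one_iff.2 (neg_neg_of_pos (by positivity)))).const_mul (C / c)
    simpa using this
  refine squeeze_zero' (Eventually.of_forall fun n => prob_nonneg _ _ _) ?_ hlim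
  filter_upwards [hlower, eventually_ge_atTop 2] with n hn hn2
  have h1 := hcard n hn2
  have h2 : (codeCount Δ n : ℝ) ≤ Nat.card (TClass Δ n) * n := by
    exact_mod_cast codeCount_le Δ n
  set M : ℝ := ((Nat.card {q : TClass Δ n // (β * μ + ε) * n < β * Yedge Δ n i j q} : ℕ) : ℝ)
    with hM
  set N : ℝ := ((Nat.card (TClass Δ n) : ℕ) : ℝ) with hN
  set E := Real.exp (t * ε / 4 * n) with hE
  have hE1 : Real.exp (-(t * ε / 4)) ^ n = E⁻¹ := by
    rw [← Real.exp_nat_mul, hE, ← Real.exp_neg]; congr 1; ring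
  have hE2 : Real.exp (-(t * ε / 4) * n) = E⁻¹ := by
    rw [hE, ← Real.exp_neg]; congr 1; ring
  have hE3 : Real.exp (t * ε / 2 * n) = E * E := by
    rw [hE, ← Real.exp_add]; congr 1; ring
  have hEpos : 0 < E := Real.exp_pos _
  rw [hE2] at hn
  rw [hE3] at h1
  have hρn : 0 < ρ ^ n := by positivity
  have h3 : c * E⁻¹ ≤ N * n * ρ ^ n := hn.trans (mul_le_mul_of_nonneg_right h2 hρn.le)
  have hn0 : (0 : ℝ) < n := by exact_mod_cast (show 0 < n by omega)
  have hNpos : 0 < N := by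
    have : 0 < N * n * ρ ^ n := lt_of_lt_of_le (by positivity) h3
    by_contra hneg
    have h4 : N ≤ 0 := not_lt.1 hneg
    have : N * n * ρ ^ n ≤ 0 := by
      rw [mul_assoc]
      exact mul_nonpos_of_nonpos_of_nonneg h4 (by positivity)
    linarith
  rw [hE1, prob, div_le_iff₀ hNpos]
  have h5 : M * (ρ ^ n * (E * E)) * (c * E⁻¹) ≤ C * (N * n * ρ ^ n) :=
    mul_le_mul h1 h3 (by positivity) hC
  have h6 : M * (ρ ^ n * E * c) ≤ C / c * (n * E⁻¹) * N * (ρ ^ n * E * c) := by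
    calc M * (ρ ^ n * E * c) = M * (ρ ^ n * (E * E)) * (c * E⁻¹) := by field_simp
      _ ≤ C * (N * n * ρ ^ n) := h5
      _ = _ := by field_simp
  exact le_of_mul_le_mul_right h6 (by positivity)

/-- For `3 ≤ Δ`, `1 ≤ i ≤ j ≤ Δ`, `2 ≤ j`, there is a constant `μ_{ij}` such
that for every `ε > 0`, the probability that the number of edges of type `(i,j)` in a uniformly
random isomorphism class of `Δ`-trees of order `n` differs from `μ_{ij}·n` by at most `ε·n`
tends to `1`. -/
theorem edge_type_concentration (Δ i j : ℕ) (hΔ : 3 ≤ Δ) (hi : 1 ≤ i) (hij : i ≤ j)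
    (hjΔ : j ≤ Δ) (hj : 2 ≤ j) :
    ∃ μ : ℝ, ∀ ε : ℝ, 0 < ε →
      Tendsto
        (fun n : ℕ => prob Δ n (fun c => |(Yedge Δ n i j c : ℝ) - μ * n| ≤ ε * n))
        atTop (𝓝 1) := by
  obtain ⟨ρ, hρ, hρ1, hfin, hgrowth⟩ := exists_radius hΔ i j
  obtain ⟨μ, hμ⟩ := exists_tilt (by omega) hρ hρ1 hfin
  refine ⟨μ, fun ε hε => ?_⟩
  have htail : ∀ β : ℝ, |β| ≤ 1 → Tendsto
      (fun n : ℕ => prob Δ n fun q => (β * μ + ε) * n < β * Yedge Δ n i j q) atTop (𝓝 0) := by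
    intro β hβ
    obtain ⟨t, ht, htfin⟩ := hμ (ε / 2) (half_pos hε) β
    exact tendsto_prob_tail hΔ hρ ht hε hβ hgrowth htfin
  have hlim : Tendsto (fun n : ℕ => 1 -
      (prob Δ n fun q => ((1 : ℝ) * μ + ε) * n < (1 : ℝ) * Yedge Δ n i j q) -
      (prob Δ n fun q => ((-1 : ℝ) * μ + ε) * n < (-1 : ℝ) * Yedge Δ n i j q)) atTop (𝓝 1) := by
    simpa using (tendsto_const_nhds.sub (htail 1 (by simp))).sub (htail (-1) (by simp))
  refine tendsto_of_tendsto_of_tendsto_of_le_of_le' hlim tendsto_const_nhds ?_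
    (Eventually.of_forall fun n => prob_le_one _ _ _)
  filter_upwards [eventually_ge_atTop 1] with n hn
  have hpos : 0 < Nat.card (TClass Δ n) := by
    have := (one_le_codeCount hΔ hn).trans (codeCount_le Δ n)
    exact Nat.pos_of_mul_pos_right this
  have := one_le_prob_add hpos (P := fun q => |(Yedge Δ n i j q : ℝ) - μ * n| ≤ ε * n)
    (Q := fun q => ((1 : ℝ) * μ + ε) * n < (1 : ℝ) * Yedge Δ n i j q)
    (R := fun q => ((-1 : ℝ) * μ + ε) * n < (-1 : ℝ) * Yedge Δ n i j q) fun q => by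
      by_contra! h
      refine absurd (abs_le.2 ⟨?_, ?_⟩) (not_le.2 h.1)
      · linarith [h.2.2]
      · linarith [h.2.1]
  linarith

end TreePaper
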